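/- arXiv:2410.15561 — 9 statements merged into one kernel-verified Lean document; each statement's English description precedes it below -/
import Mathlib

section
/- Vertices of the Nash polyhedron of a normal toric surface: let n ≥ 2 and let γ_1, …, γ_n ∈ ℤ² satisfy (i) det(γ_i γ_{i+1}) > 0 for all 1 ≤ i ≤ n−1 and det(γ_1 γ_n) > 0 (counterclockwise ordering in a strongly convex cone), (ii) the additive submonoid of ℤ² generated by {γ_1,…,γ_n} equals {v ∈ ℤ² : v ∈ C}, where C = {s·γ_1 + t·γ_n : s,t ∈ ℝ, s,t ≥ 0} ⊆ ℝ², and (iii) no γ_i lies in the additive submonoid generated by the other γ_j's (minimality). Let Θ = convexHull ℝ of (C ∩ ℤ²) \ {0} and let N = convexHull ℝ of the union over all pairs i ≠ j of the translated cones (γ_i + γ_j) + C. Then the set of extreme points of N equals { γ_i + γ_{i+1} : 1 ≤ i ≤ n−1 and (γ_i is an extreme point of Θ or γ_{i+1} is an extreme point of Θ) }. -/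
/-- The inclusion of `ℤ²` into `ℝ²`. -/
def toR2 (v : ℤ × ℤ) : ℝ × ℝ := ((v.1 : ℝ), (v.2 : ℝ))

/-- The determinant of the 2×2 integer matrix with columns `u` and `v`. -/
def det2 (u v : ℤ × ℤ) : ℤ := u.1 * v.2 - v.1 * u.2

/-- `v` lies in the closed cone spanned by `u` and `w` (when `0 < det2 u w`). -/
def InCone (u w v : ℤ × ℤ) : Prop := 0 ≤ det2 v w ∧ 0 ≤ det2 u v

/-- `g` is not a sum of two nonzero lattice points of the cone spanned by `u` and `w`. -/
def Indecomposable (u w g : ℤ × ℤ) : Prop :=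
  ∀ x y, InCone u w x → InCone u w y → x + y = g → x = 0 ∨ y = 0

section Det

lemma det2_add_left (u v w : ℤ × ℤ) : det2 (u + v) w = det2 u w + det2 v w := by
  simp only [det2, Prod.fst_add, Prod.snd_add]; ring

lemma det2_add_right (u v w : ℤ × ℤ) : det2 u (v + w) = det2 u v + det2 u w := by
  simp only [det2, Prod.fst_add, Prod.snd_add]; ring

lemma det2_sub_left (u v w : ℤ × ℤ) : det2 (u - v) w = det2 u w - det2 v w := by
  simp only [det2, Prod.fst_sub, Prod.snd_sub]; ring

lemma det2_sub_right (u v w : ℤ × ℤ) : det2 u (v - w) = det2 u v - det2 u w := by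
  simp only [det2, Prod.fst_sub, Prod.snd_sub]; ring

lemma det2_self (u : ℤ × ℤ) : det2 u u = 0 := by
  simp only [det2]; ring

lemma det2_swap (u v : ℤ × ℤ) : det2 v u = -det2 u v := by
  simp only [det2]; ring

lemma det2_zero_left (u : ℤ × ℤ) : det2 0 u = 0 := by simp [det2]

lemma det2_zero_right (u : ℤ × ℤ) : det2 u 0 = 0 := by simp [det2]

lemma det2_plucker (a b c d : ℤ × ℤ) :
    det2 a b * det2 c d = det2 c b * det2 a d + det2 a c * det2 b d := by
  simp only [det2]; ring

lemma det2_mul_fst (a b v : ℤ × ℤ) :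
    det2 a b * v.1 = det2 v b * a.1 + det2 a v * b.1 := by
  simp only [det2]; ring

lemma det2_mul_snd (a b v : ℤ × ℤ) :
    det2 a b * v.2 = det2 v b * a.2 + det2 a v * b.2 := by
  simp only [det2]; ring

end Det

section Cone

variable {u w : ℤ × ℤ}

lemma InCone.zero : InCone u w 0 := by
  simp [InCone, det2_zero_left, det2_zero_right]

lemma InCone.add {x y : ℤ × ℤ} (hx : InCone u w x) (hy : InCone u w y) :
    InCone u w (x + y) := by
  obtain ⟨h1, h2⟩ := hx
  obtain ⟨h3, h4⟩ := hy
  constructor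
  · rw [det2_add_left]; exact add_nonneg h1 h3
  · rw [det2_add_right]; exact add_nonneg h2 h4

lemma InCone.smul {x : ℤ × ℤ} (hx : InCone u w x) {m : ℤ} (hm : 0 ≤ m) :
    InCone u w (m • x) := by
  obtain ⟨h1, h2⟩ := hx
  have e1 : det2 (m • x) w = m * det2 x w := by
    simp only [det2, Prod.smul_fst, Prod.smul_snd, smul_eq_mul]; ring
  have e2 : det2 u (m • x) = m * det2 u x := by
    simp only [det2, Prod.smul_fst, Prod.smul_snd, smul_eq_mul]; ring
  exact ⟨e1 ▸ mul_nonneg hm h1, e2 ▸ mul_nonneg hm h2⟩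

/-- A lattice point of the cone spanned by two points of a cone lies in that cone. -/
lemma InCone.of_between {a b v : ℤ × ℤ} (ha : InCone u w a) (hb : InCone u w b)
    (hab : 0 < det2 a b) (hv : InCone a b v) : InCone u w v := by
  obtain ⟨h1, h2⟩ := ha
  obtain ⟨h3, h4⟩ := hb
  obtain ⟨h5, h6⟩ := hv
  constructor
  · have h := det2_plucker a b v w
    have : 0 ≤ det2 a b * det2 v w := by rw [h]; positivity
    exact nonneg_of_mul_nonneg_right this hab
  · have h := det2_plucker a b v u
    have e1 := det2_swap u v
    have e2 := det2_swap u a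
    have e3 := det2_swap u b
    have : 0 ≤ det2 a b * det2 u v := by
      have : det2 a b * det2 u v = det2 v b * det2 u a + det2 a v * det2 u b := by
        rw [e1, e2, e3] at h; linarith
      rw [this]; positivity
    exact nonneg_of_mul_nonneg_right this hab

lemma InCone.eq_zero_of_add_eq_zero (hD : 0 < det2 u w) {x y : ℤ × ℤ}
    (hx : InCone u w x) (hy : InCone u w y) (h : x + y = 0) : x = 0 := by
  obtain ⟨h1, h2⟩ := hx
  obtain ⟨h3, h4⟩ := hy
  have e1 := det2_add_left x y w
  have e2 := det2_add_right u x y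
  rw [h, det2_zero_left] at e1
  rw [h, det2_zero_right] at e2
  have z1 : det2 x w = 0 := by linarith
  have z2 : det2 u x = 0 := by linarith
  have f1 := det2_mul_fst u w x
  have f2 := det2_mul_snd u w x
  rw [z1, z2] at f1 f2
  ext
  · simpa [hD.ne'] using f1
  · simpa [hD.ne'] using f2

lemma det2_pos_trans (hD : 0 < det2 u w) {a b c : ℤ × ℤ} (ha : InCone u w a)
    (hb : InCone u w b) (hc : InCone u w c) (hab : 0 < det2 a b) (hbc : 0 < det2 b c) :
    0 < det2 a c := by
  obtain ⟨a1, a2⟩ := ha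
  obtain ⟨b1, b2⟩ := hb
  obtain ⟨c1, c2⟩ := hc
  have key : ∀ p q : ℤ × ℤ,
      det2 u w * det2 p q = det2 p w * det2 u q - det2 q w * det2 u p := by
    intro p q; simp only [det2]; ring
  have h1 : 0 < det2 a w * det2 u b - det2 b w * det2 u a := by rw [← key]; positivity
  have h2 : 0 < det2 b w * det2 u c - det2 c w * det2 u b := by rw [← key]; positivity
  have hb2 : 0 < det2 u b := by
    rcases b2.eq_or_lt with h | h
    · rw [← h] at h1; nlinarith [mul_nonneg b1 a2]
    · exact h
  have hc2 : 0 < det2 u c := by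
    rcases c2.eq_or_lt with h | h
    · rw [← h] at h2; nlinarith [mul_nonneg c1 b2]
    · exact h
  have h3 : 0 < det2 u b * (det2 u w * det2 a c) := by
    rw [key]
    nlinarith [mul_pos h1 hc2, mul_nonneg h2.le a2]
  exact pos_of_mul_pos_right (pos_of_mul_pos_right h3 hb2.le) hD.le

/-- If an indecomposable `g` lies between `a` and `b`, then it can be subtracted from `a + b`. -/
lemma Indecomposable.add_sub_inCone {g a b : ℤ × ℤ} (hg : Indecomposable u w g)
    (ha : InCone u w a) (hb : InCone u w b) (hab : 0 < det2 a b) (hgab : InCone a b g) :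
    InCone u w (a + b - g) := by
  have ha0 : a ≠ 0 := by rintro rfl; simp [det2_zero_left] at hab
  have hb0 : b ≠ 0 := by rintro rfl; simp [det2_zero_right] at hab
  obtain ⟨h1, h2⟩ := hgab
  by_cases hs : det2 a b ≤ det2 g b
  · have : InCone u w (g - a) := by
      refine InCone.of_between ha hb hab ⟨?_, ?_⟩
      · rw [det2_sub_left]; linarith
      · rw [det2_sub_right, det2_self]; linarith
    rcases hg a (g - a) ha this (by abel) with h | h
    · exact absurd h ha0
    · rw [sub_eq_zero.1 h]; simpa using hb
  by_cases ht : det2 a b ≤ det2 a g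
  · have : InCone u w (g - b) := by
      refine InCone.of_between ha hb hab ⟨?_, ?_⟩
      · rw [det2_sub_left, det2_self]; linarith
      · rw [det2_sub_right]; linarith
    rcases hg b (g - b) hb this (by abel) with h | h
    · exact absurd h hb0
    · rw [sub_eq_zero.1 h]; simpa using ha
  refine InCone.of_between ha hb hab ⟨?_, ?_⟩
  · rw [det2_sub_left, det2_add_left, det2_self]; linarith
  · rw [det2_sub_right, det2_add_right, det2_self]; linarith

/-- An indecomposable lattice point is primitive. -/
lemma Indecomposable.isCoprime {g : ℤ × ℤ} (hg : Indecomposable u w g)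
    (hgc : InCone u w g) (hg0 : g ≠ 0) : IsCoprime g.1 g.2 := by
  rw [Int.isCoprime_iff_gcd_eq_one]
  by_contra hne
  obtain ⟨x, hx⟩ := Int.gcd_dvd_left g.1 g.2
  obtain ⟨y, hy⟩ := Int.gcd_dvd_right g.1 g.2
  set d : ℤ := (Int.gcd g.1 g.2 : ℤ) with hd
  have hd0 : d ≠ 0 := by
    intro h
    rw [h] at hx hy
    exact hg0 (Prod.ext (by simpa using hx) (by simpa using hy))
  have hd2 : 2 ≤ d := by omega
  have hgv : g = d • ((x, y) : ℤ × ℤ) := by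
    ext
    · simpa using hx
    · simpa using hy
  have hv : InCone u w (x, y) := by
    obtain ⟨h1, h2⟩ := hgc
    have e1 : det2 g w = d * det2 (x, y) w := by
      rw [hgv]; simp only [det2, Prod.smul_fst, Prod.smul_snd, smul_eq_mul]; ring
    have e2 : det2 u g = d * det2 u (x, y) := by
      rw [hgv]; simp only [det2, Prod.smul_fst, Prod.smul_snd, smul_eq_mul]; ring
    rw [e1] at h1
    rw [e2] at h2
    exact ⟨nonneg_of_mul_nonneg_right h1 (by omega), nonneg_of_mul_nonneg_right h2 (by omega)⟩
  have hv0 : ((x, y) : ℤ × ℤ) ≠ 0 := by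
    intro h; rw [h] at hgv; exact hg0 (by simpa using hgv)
  rcases hg (x, y) ((d - 1) • (x, y)) hv (hv.smul (by omega))
    (by rw [hgv, sub_smul, one_smul]; abel) with h | h
  · exact hv0 h
  · rcases smul_eq_zero.1 h with h | h
    · omega
    · exact hv0 h

/-- If the determinant of two indecomposable points is not `1`, then their open parallelogram
contains a lattice point. -/
lemma exists_mem_parallelogram {a b : ℤ × ℤ} (ha : Indecomposable u w a)
    (hb : Indecomposable u w b) (hac : InCone u w a) (hbc : InCone u w b)
    (hd : 1 < det2 a b) :
    ∃ v, 0 < det2 a v ∧ det2 a v < det2 a b ∧ 0 < det2 v b ∧ det2 v b < det2 a b := by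
  have ha0 : a ≠ 0 := by rintro rfl; simp [det2_zero_left] at hd
  have hb0 : b ≠ 0 := by rintro rfl; simp [det2_zero_right] at hd
  obtain ⟨p, q, hpq⟩ := ha.isCoprime hac ha0
  have hbp := hb.isCoprime hbc hb0
  set z : ℤ × ℤ := (-q, p) with hz
  have haz : det2 a z = 1 := by simp only [det2, hz]; linarith
  set d := det2 a b with hdd
  set r := det2 z b with hr
  -- subtracting a multiple of `a` reduces the second coordinate modulo the determinant
  obtain ⟨k, hk⟩ : ∃ k, k = r / d := ⟨_, rfl⟩
  set v : ℤ × ℤ := z - k • a with hv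
  have hav : det2 a v = 1 := by
    rw [← haz]; simp only [det2, hv, Prod.fst_sub, Prod.snd_sub, Prod.smul_fst, Prod.smul_snd,
      smul_eq_mul]; ring
  have hvb : det2 v b = r % d := by
    have e : det2 v b = r - k * d := by
      rw [hr, hdd]; simp only [det2, hv, Prod.fst_sub, Prod.snd_sub, Prod.smul_fst,
        Prod.smul_snd, smul_eq_mul]; ring
    rw [e, hk, Int.emod_def]; ring
  have h0 : 0 ≤ r % d := Int.emod_nonneg _ (by omega)
  have h1 : r % d < d := Int.emod_lt_of_pos _ (by omega)
  refine ⟨v, by omega, by omega, ?_, by omega⟩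
  rw [hvb]
  refine lt_of_le_of_ne h0 fun h => ?_
  have f1 := det2_mul_fst a v b
  have f2 := det2_mul_snd a v b
  have e : det2 b v = 0 := by rw [det2_swap, hvb, ← h, neg_zero]
  rw [hav, e, ← hdd] at f1 f2
  obtain ⟨s, t, hst⟩ := hbp
  have : d ∣ 1 := ⟨s * v.1 + t * v.2, by linear_combination -hst + s * f1 + t * f2⟩
  have := Int.le_of_dvd one_pos this
  omega

end Cone

section Hilbert

variable {n : ℕ} {γ : ℕ → ℤ × ℤ}

lemma inCone_gen
    (hgen : ∀ v, v ∈ AddSubmonoid.closure {v : ℤ × ℤ | ∃ i : ℕ, 1 ≤ i ∧ i ≤ n ∧ v = γ i} ↔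
      InCone (γ 1) (γ n) v) {i : ℕ} (h1 : 1 ≤ i) (hi : i ≤ n) : InCone (γ 1) (γ n) (γ i) :=
  (hgen _).1 (AddSubmonoid.subset_closure ⟨i, h1, hi, rfl⟩)

lemma det2_pos_of_lt (hD : 0 < det2 (γ 1) (γ n))
    (hccw : ∀ i : ℕ, 1 ≤ i → i ≤ n - 1 → 0 < det2 (γ i) (γ (i + 1)))
    (hcone : ∀ i, 1 ≤ i → i ≤ n → InCone (γ 1) (γ n) (γ i)) {i j : ℕ} (h1 : 1 ≤ i)
    (hij : i < j) (hj : j ≤ n) : 0 < det2 (γ i) (γ j) := by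
  induction j, hij using Nat.le_induction with
  | base => exact hccw i h1 (by omega)
  | succ j hij ih =>
    exact det2_pos_trans hD (hcone i h1 (by omega)) (hcone j (by omega) (by omega))
      (hcone (j + 1) (by omega) hj) (ih (by omega)) (hccw j (by omega) (by omega))

lemma indecomposable_gen (hD : 0 < det2 (γ 1) (γ n))
    (hgen : ∀ v, v ∈ AddSubmonoid.closure {v : ℤ × ℤ | ∃ i : ℕ, 1 ≤ i ∧ i ≤ n ∧ v = γ i} ↔
      InCone (γ 1) (γ n) v)
    (hmin : ∀ i : ℕ, 1 ≤ i → i ≤ n →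
      γ i ∉ AddSubmonoid.closure {v : ℤ × ℤ | ∃ j : ℕ, 1 ≤ j ∧ j ≤ n ∧ j ≠ i ∧ v = γ j})
    {i : ℕ} (h1 : 1 ≤ i) (hi : i ≤ n) : Indecomposable (γ 1) (γ n) (γ i) := by
  set T := AddSubmonoid.closure {v : ℤ × ℤ | ∃ j : ℕ, 1 ≤ j ∧ j ≤ n ∧ j ≠ i ∧ v = γ j} with hT
  have key : ∀ x, InCone (γ 1) (γ n) x → x ∈ T ∨ InCone (γ 1) (γ n) (x - γ i) := by
    intro x hx
    rw [← hgen] at hx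
    induction hx using AddSubmonoid.closure_induction with
    | mem x hx =>
      obtain ⟨j, hj1, hj, rfl⟩ := hx
      by_cases hji : j = i
      · right; subst hji; rw [sub_self]; exact InCone.zero
      · left; exact AddSubmonoid.subset_closure ⟨j, hj1, hj, hji, rfl⟩
    | zero => exact Or.inl T.zero_mem
    | add x y hx hy ihx ihy =>
      rw [hgen] at hx hy
      rcases ihx with h | h
      · rcases ihy with h' | h'
        · exact Or.inl (T.add_mem h h')
        · right; rw [add_sub_assoc]; exact hx.add h'
      · right; rw [add_sub_right_comm]; exact h.add hy
  intro x y hx hy hxy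
  rcases key x hx with h | h
  · rcases key y hy with h' | h'
    · exact absurd (hxy ▸ T.add_mem h h') (hmin i h1 hi)
    · exact Or.inl (hx.eq_zero_of_add_eq_zero hD h' (by rw [← hxy]; abel))
  · exact Or.inr (hy.eq_zero_of_add_eq_zero hD h (by rw [← hxy]; abel))

lemma exists_sub_gen_inCone
    (hgen : ∀ v, v ∈ AddSubmonoid.closure {v : ℤ × ℤ | ∃ i : ℕ, 1 ≤ i ∧ i ≤ n ∧ v = γ i} ↔
      InCone (γ 1) (γ n) v) {v : ℤ × ℤ} (hv : InCone (γ 1) (γ n) v) (hv0 : v ≠ 0) :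
    ∃ k, 1 ≤ k ∧ k ≤ n ∧ InCone (γ 1) (γ n) (v - γ k) := by
  rw [← hgen] at hv
  suffices h : v = 0 ∨ ∃ k, 1 ≤ k ∧ k ≤ n ∧ InCone (γ 1) (γ n) (v - γ k) from
    h.resolve_left hv0
  clear hv0
  induction hv using AddSubmonoid.closure_induction with
  | mem x hx =>
    obtain ⟨j, hj1, hj, rfl⟩ := hx
    exact Or.inr ⟨j, hj1, hj, by rw [sub_self]; exact InCone.zero⟩
  | zero => exact Or.inl rfl
  | add x y hx hy ihx ihy =>
    rw [hgen] at hx hy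
    rcases ihx with rfl | ⟨k, hk1, hk, h⟩
    · simpa using ihy
    · exact Or.inr ⟨k, hk1, hk, by rw [add_sub_right_comm]; exact h.add hy⟩

/-- Consecutive elements of the Hilbert basis of a plane cone form a lattice basis. -/
lemma det2_consecutive_eq_one (hD : 0 < det2 (γ 1) (γ n))
    (hgen : ∀ v, v ∈ AddSubmonoid.closure {v : ℤ × ℤ | ∃ i : ℕ, 1 ≤ i ∧ i ≤ n ∧ v = γ i} ↔
      InCone (γ 1) (γ n) v)
    (hind : ∀ i, 1 ≤ i → i ≤ n → Indecomposable (γ 1) (γ n) (γ i))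
    (hpos : ∀ i j, 1 ≤ i → i < j → j ≤ n → 0 < det2 (γ i) (γ j))
    {i : ℕ} (h1 : 1 ≤ i) (hi : i + 1 ≤ n) : det2 (γ i) (γ (i + 1)) = 1 := by
  have hcone : ∀ i, 1 ≤ i → i ≤ n → InCone (γ 1) (γ n) (γ i) := fun i h1 hi =>
    inCone_gen hgen h1 hi
  have hci := hcone i h1 (by omega)
  have hci' := hcone (i + 1) (by omega) hi
  have hd := hpos i (i + 1) h1 (by omega) hi
  by_contra hne
  obtain ⟨v, hv1, hv2, hv3, hv4⟩ := exists_mem_parallelogram (hind i h1 (by omega))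
    (hind (i + 1) (by omega) hi) hci hci' (by omega)
  have hvc : InCone (γ 1) (γ n) v := hci.of_between hci' hd ⟨hv3.le, hv1.le⟩
  have hv0 : v ≠ 0 := by rintro rfl; simp [det2_zero_right] at hv1
  have hrest : InCone (γ 1) (γ n) (γ i + γ (i + 1) - v) := by
    refine hci.of_between hci' hd ⟨?_, ?_⟩
    · rw [det2_sub_left, det2_add_left, det2_self]; linarith
    · rw [det2_sub_right, det2_add_right, det2_self]; linarith
  have hrest0 : γ i + γ (i + 1) - v ≠ 0 := by
    intro h
    have := congrArg (det2 (γ i)) h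
    rw [det2_sub_right, det2_add_right, det2_self, det2_zero_right] at this
    linarith
  obtain ⟨k, hk1, hk, hvk⟩ := exists_sub_gen_inCone hgen hvc hv0
  rcases Nat.lt_or_ge i k with hik | hik
  · have hsub : InCone (γ 1) (γ n) (v - γ (i + 1)) := by
      rcases Nat.eq_or_lt_of_le (show i + 1 ≤ k from hik) with rfl | hlt
      · exact hvk
      have hp := hpos (i + 1) k (by omega) hlt hk
      have hvk' := det2_pos_trans hD hvc hci' (hcone k hk1 hk) hv3 hp
      have := (hind (i + 1) (by omega) hi).add_sub_inCone hvk (hcone k hk1 hk)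
        (by rw [det2_sub_left, det2_self]; linarith) ⟨hp.le, by
          rw [det2_sub_left, det2_swap (γ (i + 1)) (γ k)]; linarith⟩
      simpa using this
    rcases hind i h1 (by omega) (v - γ (i + 1)) _ hsub hrest (by abel) with h | h
    · rw [sub_eq_zero.1 h, det2_self] at hv3; exact hv3.false
    · exact hrest0 h
  · have hsub : InCone (γ 1) (γ n) (v - γ i) := by
      rcases Nat.eq_or_lt_of_le hik with rfl | hlt
      · exact hvk
      have hp := hpos k i hk1 hlt (by omega)
      have hvk' := det2_pos_trans hD (hcone k hk1 hk) hci hvc hp hv1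
      have := (hind i h1 (by omega)).add_sub_inCone (hcone k hk1 hk) hvk
        (by rw [det2_sub_right, det2_self]; linarith) ⟨by
          rw [det2_sub_right, det2_swap (γ k) (γ i)]; linarith, hp.le⟩
      simpa using this
    rcases hind (i + 1) (by omega) hi (v - γ i) _ hsub hrest (by abel) with h | h
    · rw [sub_eq_zero.1 h, det2_self] at hv1; exact hv1.false
    · exact hrest0 h

lemma add_eq_smul_of_det2_eq_one {a b c : ℤ × ℤ} (hab : det2 a b = 1) (hbc : det2 b c = 1) :
    a + c = det2 a c • b := by
  have f1 := det2_mul_fst b c a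
  have f2 := det2_mul_snd b c a
  rw [hbc, det2_swap a b, hab] at f1 f2
  ext
  · simp only [Prod.fst_add, Prod.smul_fst, smul_eq_mul]; linarith
  · simp only [Prod.snd_add, Prod.smul_snd, smul_eq_mul]; linarith

end Hilbert

section Sequence

variable {n : ℕ} {F a : ℕ → ℤ}

lemma linear_growth (hrec : ∀ i, 1 ≤ i → i + 2 ≤ n → F i + F (i + 2) = a i * F (i + 1))
    (ha : ∀ i, 1 ≤ i → i + 2 ≤ n → 2 ≤ a i) {k : ℕ} (hk : 1 ≤ k) (h0 : 0 ≤ F k)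
    (h1 : F k ≤ F (k + 1)) (m : ℕ) (hm : k + 1 + m ≤ n) :
    F (k + 1) + m * (F (k + 1) - F k) ≤ F (k + 1 + m) := by
  have step : ∀ m, k + 1 + m ≤ n →
      0 ≤ F (k + m) ∧ F (k + m) + (F (k + 1) - F k) ≤ F (k + m + 1) := by
    intro m
    induction m with
    | zero => intro _; exact ⟨h0, by simp⟩
    | succ m ih =>
      intro hm
      obtain ⟨i0, i1⟩ := ih (by omega)
      have hr := hrec (k + m) (by omega) (by omega)
      have h2 := ha (k + m) (by omega) (by omega)
      have hnn : 0 ≤ F (k + m + 1) := by linarith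
      refine ⟨hnn, ?_⟩
      have : F (k + (m + 1)) + (F (k + 1) - F k) ≤ F (k + m + 2) := by
        rw [← add_assoc]
        nlinarith
      exact this
  induction m with
  | zero => simp
  | succ m ih =>
    have h3 := (step (m + 1) hm).2
    have h4 := ih (by omega)
    rw [show k + (m + 1) = k + 1 + m by ring] at h3
    rw [show k + 1 + (m + 1) = k + 1 + m + 1 by ring]
    push_cast
    linarith

lemma rec_reverse (hrec : ∀ i, 1 ≤ i → i + 2 ≤ n → F i + F (i + 2) = a i * F (i + 1))
    (i : ℕ) (h1 : 1 ≤ i) (hi : i + 2 ≤ n) :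
    F (n + 1 - i) + F (n + 1 - (i + 2)) = a (n + 1 - (i + 2)) * F (n + 1 - (i + 1)) := by
  have h := hrec (n + 1 - (i + 2)) (by omega) (by omega)
  rw [show n + 1 - (i + 2) + 2 = n + 1 - i by omega,
    show n + 1 - (i + 2) + 1 = n + 1 - (i + 1) by omega] at h
  linarith

lemma five_le_of_left (hrec : ∀ i, 1 ≤ i → i + 2 ≤ n → F i + F (i + 2) = a i * F (i + 1))
    (ha : ∀ i, 1 ≤ i → i + 2 ≤ n → 2 ≤ a i) {i : ℕ} (h1 : 1 ≤ i) (hi : i + 1 ≤ n)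
    (hF : F i = 3) (hF' : F (i + 1) = 4) (hv : i = 1 ∨ 3 ≤ a (i - 1)) :
    ∀ j, 1 ≤ j → j ≤ n → j ≠ i → j ≠ i + 1 → 5 ≤ F j := by
  intro j hj1 hj hji hji'
  rcases Nat.lt_or_ge i j with h | h
  · obtain ⟨m, rfl⟩ : ∃ m, j = i + 1 + m := ⟨j - (i + 1), by omega⟩
    have hg := linear_growth hrec ha h1 (by omega) (by omega) m hj
    rw [hF, hF'] at hg
    have : (1 : ℤ) ≤ m := by
      have : 1 ≤ m := by omega
      exact_mod_cast this
    linarith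
  · have hi2 : 2 ≤ i := by omega
    have h3 : 3 ≤ a (i - 1) := hv.resolve_left (by omega)
    have hr := hrec (i - 1) (by omega) (by omega)
    rw [show i - 1 + 1 = i by omega, show i - 1 + 2 = i + 1 by omega, hF, hF'] at hr
    have hg := linear_growth (F := fun j => F (n + 1 - j)) (a := fun i => a (n + 1 - (i + 2)))
      (rec_reverse hrec) (fun i h1 hi => ha _ (by omega) (by omega)) (k := n + 1 - i)
      (by omega)
    simp only [show n + 1 - (n + 1 - i) = i by omega,
      show n + 1 - (n + 1 - i + 1) = i - 1 by omega] at hg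
    have hg' := hg (by omega) (by omega) (i - 1 - j) (by omega)
    rw [show n + 1 - (n + 1 - i + 1 + (i - 1 - j)) = j by omega] at hg'
    have : (0 : ℤ) ≤ ((i - 1 - j : ℕ) : ℤ) * (F (i - 1) - F i) :=
      mul_nonneg (by positivity) (by omega)
    linarith

lemma five_le_of_right (hrec : ∀ i, 1 ≤ i → i + 2 ≤ n → F i + F (i + 2) = a i * F (i + 1))
    (ha : ∀ i, 1 ≤ i → i + 2 ≤ n → 2 ≤ a i) {i : ℕ} (h1 : 1 ≤ i) (hi : i + 1 ≤ n)
    (hF : F i = 4) (hF' : F (i + 1) = 3) (hv : i + 1 = n ∨ 3 ≤ a i) :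
    ∀ j, 1 ≤ j → j ≤ n → j ≠ i → j ≠ i + 1 → 5 ≤ F j := by
  intro j hj1 hj hji hji'
  have h := five_le_of_left (F := fun j => F (n + 1 - j)) (a := fun i => a (n + 1 - (i + 2)))
      (rec_reverse hrec) (fun i h1 hi => ha _ (by omega) (by omega)) (i := n - i)
      (by omega) (by omega) (by simp only [show n + 1 - (n - i) = i + 1 by omega, hF'])
      (by simp only [show n + 1 - (n - i + 1) = i by omega, hF])
      (by
        rcases hv with hv | hv
        · left; omega
        · by_cases hin : i + 1 = n
          · left; omega
          · right; simpa only [show n + 1 - (n - i - 1 + 2) = i by omega] using hv)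
      (n + 1 - j) (by omega) (by omega) (by omega) (by omega)
  simpa only [show n + 1 - (n + 1 - j) = j by omega] using h

end Sequence

section Basis

variable {n : ℕ} {γ : ℕ → ℤ × ℤ}

lemma two_le_det2 (hcone : ∀ i, 1 ≤ i → i ≤ n → InCone (γ 1) (γ n) (γ i))
    (hind : ∀ i, 1 ≤ i → i ≤ n → Indecomposable (γ 1) (γ n) (γ i))
    (hpos : ∀ i j, 1 ≤ i → i < j → j ≤ n → 0 < det2 (γ i) (γ j))
    (hrec : ∀ i, 1 ≤ i → i + 2 ≤ n → γ i + γ (i + 2) = det2 (γ i) (γ (i + 2)) • γ (i + 1))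
    (i : ℕ) (h1 : 1 ≤ i) (hi : i + 2 ≤ n) : 2 ≤ det2 (γ i) (γ (i + 2)) := by
  have h := hpos i (i + 2) h1 (by omega) hi
  by_contra hlt
  have e := hrec i h1 hi
  rw [show det2 (γ i) (γ (i + 2)) = 1 by omega, one_smul] at e
  rcases hind (i + 1) (by omega) (by omega) _ _ (hcone i h1 (by omega))
    (hcone (i + 2) (by omega) hi) e with h0 | h0
  · rw [h0, det2_zero_left] at h; exact h.false
  · rw [h0, det2_zero_right] at h; exact h.false

/-- The increments of the Hilbert basis differ by elements of the cone. -/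
lemma inCone_increment_sub (hcone : ∀ i, 1 ≤ i → i ≤ n → InCone (γ 1) (γ n) (γ i))
    (hrec : ∀ i, 1 ≤ i → i + 2 ≤ n → γ i + γ (i + 2) = det2 (γ i) (γ (i + 2)) • γ (i + 1))
    (htwo : ∀ i, 1 ≤ i → i + 2 ≤ n → 2 ≤ det2 (γ i) (γ (i + 2)))
    {i : ℕ} (h1 : 1 ≤ i) (m : ℕ) (hm : i + m + 2 ≤ n) :
    InCone (γ 1) (γ n) (γ i + γ (i + m + 2) - γ (i + 1) - γ (i + m + 1)) := by
  have hstep : ∀ k, 1 ≤ k → k + 2 ≤ n →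
      InCone (γ 1) (γ n) (γ k + γ (k + 2) - γ (k + 1) - γ (k + 1)) := by
    intro k hk hkn
    have e : γ k + γ (k + 2) - γ (k + 1) - γ (k + 1) =
        (det2 (γ k) (γ (k + 2)) - 2) • γ (k + 1) := by
      rw [hrec k hk hkn, sub_smul, two_smul]; abel
    rw [e]
    exact (hcone (k + 1) (by omega) (by omega)).smul (by linarith [htwo k hk hkn])
  induction m with
  | zero => exact hstep i h1 hm
  | succ m ih =>
    have h := (ih (by omega)).add (hstep (i + m + 1) (by omega) (by omega))
    convert h using 1
    rw [show i + (m + 1) + 2 = i + m + 1 + 2 by ring, show i + (m + 1) + 1 = i + m + 2 by ring,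
      show i + m + 1 + 1 = i + m + 2 by ring]
    abel

lemma eval_recurrence {a b c : ℤ × ℤ} {d : ℤ} (h : a + c = d • b) (α β : ℤ) :
    (α * a.1 + β * a.2) + (α * c.1 + β * c.2) = d * (α * b.1 + β * b.2) := by
  have h1 := congrArg Prod.fst h
  have h2 := congrArg Prod.snd h
  simp only [Prod.fst_add, Prod.snd_add, Prod.smul_fst, Prod.smul_snd, smul_eq_mul] at h1 h2
  linear_combination α * h1 + β * h2

lemma exists_functional_left (hone : ∀ i, 1 ≤ i → i + 1 ≤ n → det2 (γ i) (γ (i + 1)) = 1)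
    (hrec : ∀ i, 1 ≤ i → i + 2 ≤ n → γ i + γ (i + 2) = det2 (γ i) (γ (i + 2)) • γ (i + 1))
    (htwo : ∀ i, 1 ≤ i → i + 2 ≤ n → 2 ≤ det2 (γ i) (γ (i + 2)))
    {i : ℕ} (h1 : 1 ≤ i) (hi : i + 1 ≤ n)
    (hv : i = 1 ∨ 3 ≤ det2 (γ (i - 1)) (γ (i - 1 + 2))) :
    ∃ α β : ℤ, α * (γ i).1 + β * (γ i).2 = 3 ∧ α * (γ (i + 1)).1 + β * (γ (i + 1)).2 = 4 ∧
      ∀ j, 1 ≤ j → j ≤ n → j ≠ i → j ≠ i + 1 → 5 ≤ α * (γ j).1 + β * (γ j).2 := by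
  have h := hone i h1 hi
  simp only [det2] at h
  have e1 : (3 * (γ (i + 1)).2 - 4 * (γ i).2) * (γ i).1 +
      (4 * (γ i).1 - 3 * (γ (i + 1)).1) * (γ i).2 = 3 := by linear_combination 3 * h
  have e2 : (3 * (γ (i + 1)).2 - 4 * (γ i).2) * (γ (i + 1)).1 +
      (4 * (γ i).1 - 3 * (γ (i + 1)).1) * (γ (i + 1)).2 = 4 := by linear_combination 4 * h
  exact ⟨_, _, e1, e2, five_le_of_left
    (F := fun j => (3 * (γ (i + 1)).2 - 4 * (γ i).2) * (γ j).1 +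
      (4 * (γ i).1 - 3 * (γ (i + 1)).1) * (γ j).2) (a := fun i => det2 (γ i) (γ (i + 2)))
    (fun k hk hkn => eval_recurrence (hrec k hk hkn) _ _) htwo h1 hi e1 e2 hv⟩

lemma exists_functional_right (hone : ∀ i, 1 ≤ i → i + 1 ≤ n → det2 (γ i) (γ (i + 1)) = 1)
    (hrec : ∀ i, 1 ≤ i → i + 2 ≤ n → γ i + γ (i + 2) = det2 (γ i) (γ (i + 2)) • γ (i + 1))
    (htwo : ∀ i, 1 ≤ i → i + 2 ≤ n → 2 ≤ det2 (γ i) (γ (i + 2)))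
    {i : ℕ} (h1 : 1 ≤ i) (hi : i + 1 ≤ n)
    (hv : i + 1 = n ∨ 3 ≤ det2 (γ i) (γ (i + 2))) :
    ∃ α β : ℤ, α * (γ i).1 + β * (γ i).2 = 4 ∧ α * (γ (i + 1)).1 + β * (γ (i + 1)).2 = 3 ∧
      ∀ j, 1 ≤ j → j ≤ n → j ≠ i → j ≠ i + 1 → 5 ≤ α * (γ j).1 + β * (γ j).2 := by
  have h := hone i h1 hi
  simp only [det2] at h
  have e1 : (4 * (γ (i + 1)).2 - 3 * (γ i).2) * (γ i).1 +
      (3 * (γ i).1 - 4 * (γ (i + 1)).1) * (γ i).2 = 4 := by linear_combination 4 * h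
  have e2 : (4 * (γ (i + 1)).2 - 3 * (γ i).2) * (γ (i + 1)).1 +
      (3 * (γ i).1 - 4 * (γ (i + 1)).1) * (γ (i + 1)).2 = 3 := by linear_combination 3 * h
  exact ⟨_, _, e1, e2, five_le_of_right
    (F := fun j => (4 * (γ (i + 1)).2 - 3 * (γ i).2) * (γ j).1 +
      (3 * (γ i).1 - 4 * (γ (i + 1)).1) * (γ j).2) (a := fun i => det2 (γ i) (γ (i + 2)))
    (fun k hk hkn => eval_recurrence (hrec k hk hkn) _ _) htwo h1 hi e1 e2 hv⟩

end Basis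

section Extreme

lemma toR2_add (u v : ℤ × ℤ) : toR2 (u + v) = toR2 u + toR2 v := by
  ext <;> simp [toR2]

lemma toR2_sub (u v : ℤ × ℤ) : toR2 (u - v) = toR2 u - toR2 v := by
  ext <;> simp [toR2]

lemma toR2_injective : Function.Injective toR2 := by
  intro u v h
  have h1 := congrArg Prod.fst h
  have h2 := congrArg Prod.snd h
  simp only [toR2, Int.cast_inj] at h1 h2
  exact Prod.ext h1 h2

lemma toR2_zero : toR2 0 = 0 := by
  ext <;> simp [toR2]

lemma notMem_extremePoints_of_add_self_eq {A : Set (ℝ × ℝ)} {p x y : ℝ × ℝ} (hx : x ∈ A)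
    (hy : y ∈ A) (hxy : x ≠ y) (hp : p + p = x + y) : p ∉ Set.extremePoints ℝ A := by
  intro h
  have hseg : p ∈ openSegment ℝ x y := by
    refine ⟨1 / 2, 1 / 2, by norm_num, by norm_num, by norm_num, ?_⟩
    rw [← smul_add, ← hp, ← two_smul ℝ p, smul_smul]
    norm_num
  have e := (mem_extremePoints.1 h).2 x hx y hy hseg
  exact hxy (e.1.trans e.2.symm)

/-- A point of `X` that is the unique minimizer on `X` of a linear functional is a vertex of the
convex hull of `X`. -/
lemma mem_extremePoints_convexHull_of_unique_min {X : Set (ℝ × ℝ)} {q : ℝ × ℝ} (α β : ℝ)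
    (hq : q ∈ X) (hmin : ∀ x ∈ X, x ≠ q → α * q.1 + β * q.2 < α * x.1 + β * x.2) :
    q ∈ Set.extremePoints ℝ (convexHull ℝ X) := by
  have hsub : convexHull ℝ X ⊆ {x | x = q ∨ α * q.1 + β * q.2 < α * x.1 + β * x.2} := by
    refine convexHull_min (fun x hx => ?_) ?_
    · by_cases h : x = q
      · exact Or.inl h
      · exact Or.inr (hmin x hx h)
    · rintro x hx y hy a b ha hb hab
      simp only [Set.mem_ofPred_eq, Prod.fst_add, Prod.snd_add, Prod.smul_fst, Prod.smul_snd,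
        smul_eq_mul] at hx hy ⊢
      obtain rfl : b = 1 - a := by linarith
      rcases hx with rfl | hx <;> rcases hy with rfl | hy
      · left; rw [← add_smul, hab, one_smul]
      · rcases hb.eq_or_lt with h | h
        · left; rw [← h, zero_smul, add_zero, show a = 1 by linarith, one_smul]
        · right; nlinarith
      · rcases ha.eq_or_lt with h | h
        · left; rw [← h, zero_smul, zero_add, sub_zero, one_smul]
        · right; nlinarith
      · right
        rcases ha.eq_or_lt with h | h
        · subst h; linarith
        · nlinarith [mul_nonneg hb (sub_nonneg.2 hy.le), mul_pos h (sub_pos.2 hx)]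
  refine mem_extremePoints.2 ⟨subset_convexHull ℝ X hq, ?_⟩
  rintro x hx y hy ⟨a, b, ha, hb, hab, hxy⟩
  have h1 : α * q.1 + β * q.2 =
      a * (α * x.1 + β * x.2) + b * (α * y.1 + β * y.2) := by
    rw [← hxy]; simp only [Prod.fst_add, Prod.snd_add, Prod.smul_fst, Prod.smul_snd, smul_eq_mul]
    ring
  obtain rfl : b = 1 - a := by linarith
  rcases hsub hx with h2 | h2 <;> rcases hsub hy with h3 | h3
  · exact ⟨h2, h3⟩
  · rw [h2] at h1; nlinarith
  · rw [h3] at h1; nlinarith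
  · nlinarith

end Extreme

section Polyhedra

variable {n : ℕ} {γ : ℕ → ℤ × ℤ} {C : Set (ℝ × ℝ)}

lemma toR2_mem_cone_iff (hD : 0 < det2 (γ 1) (γ n))
    (hC : C = {p : ℝ × ℝ | ∃ s t : ℝ, 0 ≤ s ∧ 0 ≤ t ∧
      p = s • toR2 (γ 1) + t • toR2 (γ n)}) (v : ℤ × ℤ) :
    toR2 v ∈ C ↔ InCone (γ 1) (γ n) v := by
  have hD' : (0 : ℝ) < det2 (γ 1) (γ n) := by exact_mod_cast hD
  rw [hC]
  constructor
  · rintro ⟨s, t, hs, ht, h⟩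
    have h1 := congrArg Prod.fst h
    have h2 := congrArg Prod.snd h
    simp only [toR2, Prod.fst_add, Prod.snd_add, Prod.smul_fst, Prod.smul_snd,
      smul_eq_mul] at h1 h2
    constructor
    · have : (0 : ℝ) ≤ det2 v (γ n) := by
        have e : (det2 v (γ n) : ℝ) = s * det2 (γ 1) (γ n) := by
          simp only [det2]; push_cast; rw [h1, h2]; ring
        rw [e]; positivity
      exact_mod_cast this
    · have : (0 : ℝ) ≤ det2 (γ 1) v := by
        have e : (det2 (γ 1) v : ℝ) = t * det2 (γ 1) (γ n) := by
          simp only [det2]; push_cast; rw [h1, h2]; ring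
        rw [e]; positivity
      exact_mod_cast this
  · rintro ⟨h1, h2⟩
    have h1' : (0 : ℝ) ≤ det2 v (γ n) := by exact_mod_cast h1
    have h2' : (0 : ℝ) ≤ det2 (γ 1) v := by exact_mod_cast h2
    refine ⟨det2 v (γ n) / det2 (γ 1) (γ n), det2 (γ 1) v / det2 (γ 1) (γ n),
      by positivity, by positivity, ?_⟩
    have f1 : (det2 (γ 1) (γ n) : ℝ) * v.1 =
        det2 v (γ n) * (γ 1).1 + det2 (γ 1) v * (γ n).1 := by
      exact_mod_cast det2_mul_fst (γ 1) (γ n) v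
    have f2 : (det2 (γ 1) (γ n) : ℝ) * v.2 =
        det2 v (γ n) * (γ 1).2 + det2 (γ 1) v * (γ n).2 := by
      exact_mod_cast det2_mul_snd (γ 1) (γ n) v
    ext
    · simp only [toR2, Prod.fst_add, Prod.smul_fst, smul_eq_mul]
      field_simp
      linarith
    · simp only [toR2, Prod.snd_add, Prod.smul_snd, smul_eq_mul]
      field_simp
      linarith

lemma cone_smul_mem (hC : C = {p : ℝ × ℝ | ∃ s t : ℝ, 0 ≤ s ∧ 0 ≤ t ∧
      p = s • toR2 (γ 1) + t • toR2 (γ n)}) {c : ℝ × ℝ} (hc : c ∈ C) {r : ℝ} (hr : 0 ≤ r) :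
    r • c ∈ C := by
  rw [hC] at hc ⊢
  obtain ⟨s, t, hs, ht, rfl⟩ := hc
  exact ⟨r * s, r * t, by positivity, by positivity, by simp only [smul_add, smul_smul]⟩

variable {α β : ℤ} {p q : ℕ}

lemma three_le_functional (hp : α * (γ p).1 + β * (γ p).2 = 3)
    (hq : α * (γ q).1 + β * (γ q).2 = 4)
    (hj : ∀ j, 1 ≤ j → j ≤ n → j ≠ p → j ≠ q → 5 ≤ α * (γ j).1 + β * (γ j).2)
    {j : ℕ} (h1 : 1 ≤ j) (hjn : j ≤ n) : 3 ≤ α * (γ j).1 + β * (γ j).2 := by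
  by_cases h : j = p
  · rw [h, hp]
  by_cases h' : j = q
  · rw [h', hq]; norm_num
  linarith [hj j h1 hjn h h']

lemma mem_extremePoints_theta (hn : 1 ≤ n) (hD : 0 < det2 (γ 1) (γ n))
    (hgen : ∀ v, v ∈ AddSubmonoid.closure {v : ℤ × ℤ | ∃ i : ℕ, 1 ≤ i ∧ i ≤ n ∧ v = γ i} ↔
      InCone (γ 1) (γ n) v)
    (hmem : ∀ v, toR2 v ∈ C ↔ InCone (γ 1) (γ n) v) (hp1 : 1 ≤ p) (hpn : p ≤ n)
    (hp : α * (γ p).1 + β * (γ p).2 = 3) (hq : α * (γ q).1 + β * (γ q).2 = 4)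
    (hj : ∀ j, 1 ≤ j → j ≤ n → j ≠ p → j ≠ q → 5 ≤ α * (γ j).1 + β * (γ j).2) :
    toR2 (γ p) ∈
      Set.extremePoints ℝ (convexHull ℝ ({p ∈ C | ∃ v : ℤ × ℤ, p = toR2 v} \ {0})) := by
  have h3 : ∀ j, 1 ≤ j → j ≤ n → 3 ≤ α * (γ j).1 + β * (γ j).2 := fun j h1 h2 =>
    three_le_functional hp hq hj h1 h2
  have hnn : ∀ v, InCone (γ 1) (γ n) v → 0 ≤ α * v.1 + β * v.2 := by
    rintro v ⟨h1, h2⟩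
    have f1 := det2_mul_fst (γ 1) (γ n) v
    have f2 := det2_mul_snd (γ 1) (γ n) v
    have : 0 ≤ det2 (γ 1) (γ n) * (α * v.1 + β * v.2) := by
      have e : det2 (γ 1) (γ n) * (α * v.1 + β * v.2) =
          det2 v (γ n) * (α * (γ 1).1 + β * (γ 1).2) +
          det2 (γ 1) v * (α * (γ n).1 + β * (γ n).2) := by
        linear_combination α * f1 + β * f2
      rw [e]
      have := h3 1 le_rfl hn
      have := h3 n hn le_rfl
      exact add_nonneg (mul_nonneg h1 (by linarith)) (mul_nonneg h2 (by linarith))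
    exact nonneg_of_mul_nonneg_right this hD
  refine mem_extremePoints_convexHull_of_unique_min (α : ℝ) (β : ℝ) ?_ ?_
  · refine ⟨⟨(hmem _).2 (inCone_gen hgen hp1 hpn), _, rfl⟩, fun h => ?_⟩
    have : γ p = 0 := toR2_injective (by rw [toR2_zero]; exact h)
    rw [this] at hp
    simp at hp
  · rintro _ ⟨⟨hx, v, rfl⟩, hx0⟩ hne
    have hv0 : v ≠ 0 := by rintro rfl; exact hx0 toR2_zero
    have hvp : v ≠ γ p := by rintro rfl; exact hne rfl
    suffices h : α * (γ p).1 + β * (γ p).2 < α * v.1 + β * v.2 by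
      simp only [toR2]; exact_mod_cast h
    obtain ⟨k, hk1, hk, hvk⟩ := exists_sub_gen_inCone hgen ((hmem v).1 hx) hv0
    have h0 := hnn _ hvk
    simp only [Prod.fst_sub, Prod.snd_sub] at h0
    by_cases hkp : k = p
    · subst hkp
      obtain ⟨l, hl1, hl, hvl⟩ := exists_sub_gen_inCone hgen hvk (sub_ne_zero.2 hvp)
      have h0 := hnn _ hvl
      simp only [Prod.fst_sub, Prod.snd_sub] at h0
      linarith [h3 l hl1 hl]
    · have : 4 ≤ α * (γ k).1 + β * (γ k).2 := by
        by_cases hkq : k = q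
        · rw [hkq, hq]
        · linarith [hj k hk1 hk hkp hkq]
      linarith

lemma mem_extremePoints_nash (hn : 1 ≤ n)
    (hC : C = {p : ℝ × ℝ | ∃ s t : ℝ, 0 ≤ s ∧ 0 ≤ t ∧
      p = s • toR2 (γ 1) + t • toR2 (γ n)})
    (hp1 : 1 ≤ p) (hpn : p ≤ n) (hq1 : 1 ≤ q) (hqn : q ≤ n)
    (hp : α * (γ p).1 + β * (γ p).2 = 3) (hq : α * (γ q).1 + β * (γ q).2 = 4)
    (hj : ∀ j, 1 ≤ j → j ≤ n → j ≠ p → j ≠ q → 5 ≤ α * (γ j).1 + β * (γ j).2) :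
    toR2 (γ p + γ q) ∈ Set.extremePoints ℝ (convexHull ℝ
      (⋃ i ∈ Set.Icc 1 n, ⋃ j ∈ Set.Icc 1 n, ⋃ (_ : i ≠ j),
        (fun c : ℝ × ℝ => toR2 (γ i + γ j) + c) '' C)) := by
  have h3 : ∀ j, 1 ≤ j → j ≤ n → 3 ≤ α * (γ j).1 + β * (γ j).2 := fun j h1 h2 =>
    three_le_functional hp hq hj h1 h2
  have hpq : p ≠ q := by rintro rfl; omega
  have hCpos : ∀ c ∈ C, c = 0 ∨ 0 < (α : ℝ) * c.1 + β * c.2 := by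
    rw [hC]
    rintro c ⟨s, t, hs, ht, rfl⟩
    have a1 : (3 : ℝ) ≤ α * (γ 1).1 + β * (γ 1).2 := by exact_mod_cast h3 1 le_rfl hn
    have a2 : (3 : ℝ) ≤ α * (γ n).1 + β * (γ n).2 := by exact_mod_cast h3 n hn le_rfl
    have e : (α : ℝ) * (s • toR2 (γ 1) + t • toR2 (γ n)).1 +
        β * (s • toR2 (γ 1) + t • toR2 (γ n)).2 =
        s * (α * (γ 1).1 + β * (γ 1).2) + t * (α * (γ n).1 + β * (γ n).2) := by
      simp only [toR2, Prod.fst_add, Prod.snd_add, Prod.smul_fst, Prod.smul_snd, smul_eq_mul]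
      ring
    rw [e]
    rcases hs.eq_or_lt with rfl | hs
    · rcases ht.eq_or_lt with rfl | ht
      · left; simp
      · right; rw [zero_mul, zero_add]; exact mul_pos ht (by linarith)
    · right
      exact add_pos_of_pos_of_nonneg (mul_pos hs (by linarith)) (mul_nonneg ht (by linarith))
  refine mem_extremePoints_convexHull_of_unique_min (α : ℝ) (β : ℝ) ?_ ?_
  · simp only [Set.mem_iUnion]
    refine ⟨p, ⟨hp1, hpn⟩, q, ⟨hq1, hqn⟩, hpq, 0, ?_, add_zero _⟩
    rw [hC]
    exact ⟨0, 0, le_rfl, le_rfl, by simp⟩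
  · intro x hx hne
    simp only [Set.mem_iUnion] at hx
    obtain ⟨i, ⟨hi1, hi⟩, j, ⟨hj1, hjn⟩, hij, c, hc, rfl⟩ := hx
    have hp' : (α : ℝ) * (γ p).1 + β * (γ p).2 = 3 := by exact_mod_cast hp
    have hq' : (α : ℝ) * (γ q).1 + β * (γ q).2 = 4 := by exact_mod_cast hq
    have e : (α : ℝ) * (toR2 (γ i + γ j) + c).1 + β * (toR2 (γ i + γ j) + c).2 =
        (α * (γ i).1 + β * (γ i).2) + (α * (γ j).1 + β * (γ j).2) + (α * c.1 + β * c.2) := by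
      simp only [toR2, Prod.fst_add, Prod.snd_add]; push_cast; ring
    have e' : (α : ℝ) * (toR2 (γ p + γ q)).1 + β * (toR2 (γ p + γ q)).2 = 7 := by
      simp only [toR2, Prod.fst_add, Prod.snd_add]; push_cast; linarith
    simp only [e, e']
    have hc0 : 0 ≤ (α : ℝ) * c.1 + β * c.2 := by
      rcases hCpos c hc with rfl | h
      · simp
      · exact h.le
    by_cases hset : (i = p ∧ j = q) ∨ (i = q ∧ j = p)
    · have hγ : γ i + γ j = γ p + γ q := by
        rcases hset with ⟨rfl, rfl⟩ | ⟨rfl, rfl⟩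
        · rfl
        · exact add_comm _ _
      have hc0 : 0 < (α : ℝ) * c.1 + β * c.2 := by
        refine (hCpos c hc).resolve_left ?_
        rintro rfl
        exact hne (by simp [hγ])
      rcases hset with ⟨rfl, rfl⟩ | ⟨rfl, rfl⟩ <;> linarith
    · have h8 : 8 ≤ (α * (γ i).1 + β * (γ i).2) + (α * (γ j).1 + β * (γ j).2) := by
        have a1 := h3 i hi1 hi
        have a2 := h3 j hj1 hjn
        by_cases b1 : i = p ∨ i = q
        · have := hj j hj1 hjn (by omega) (by omega)
          linarith
        · have := hj i hi1 hi (by omega) (by omega)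
          linarith
      have h8' : (8 : ℝ) ≤ (α * (γ i).1 + β * (γ i).2) + (α * (γ j).1 + β * (γ j).2) := by
        exact_mod_cast h8
      linarith

end Polyhedra

/-- Vertices of the Nash polyhedron of a normal toric surface: if `γ_1, …, γ_n` is the
minimal generating set, ordered counterclockwise, of the semigroup of integral points of
the strongly convex cone `C` spanned by `γ_1` and `γ_n`, then the vertices of the Nash
polyhedron `N = conv(⋃_{i ≠ j} (γ_i + γ_j) + C)` are exactly the sums
`γ_i + γ_{i+1}` for which `γ_i` or `γ_{i+1}` is a vertex of
`Θ = conv((C ∩ ℤ²) \ {0})`. -/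
theorem nash_polyhedron_vertices (n : ℕ) (hn : 2 ≤ n) (γ : ℕ → ℤ × ℤ)
    (hccw : ∀ i : ℕ, 1 ≤ i → i ≤ n - 1 → 0 < det2 (γ i) (γ (i + 1)))
    (hconvex : 0 < det2 (γ 1) (γ n))
    (C : Set (ℝ × ℝ))
    (hC : C = {p : ℝ × ℝ | ∃ s t : ℝ, 0 ≤ s ∧ 0 ≤ t ∧
      p = s • toR2 (γ 1) + t • toR2 (γ n)})
    (hgen : (AddSubmonoid.closure {v : ℤ × ℤ | ∃ i : ℕ, 1 ≤ i ∧ i ≤ n ∧ v = γ i} :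
        Set (ℤ × ℤ)) = {v : ℤ × ℤ | toR2 v ∈ C})
    (hmin : ∀ i : ℕ, 1 ≤ i → i ≤ n →
      γ i ∉ AddSubmonoid.closure {v : ℤ × ℤ | ∃ j : ℕ, 1 ≤ j ∧ j ≤ n ∧ j ≠ i ∧ v = γ j})
    (Θ N : Set (ℝ × ℝ))
    (hΘ : Θ = convexHull ℝ ({p ∈ C | ∃ v : ℤ × ℤ, p = toR2 v} \ {0}))
    (hN : N = convexHull ℝ
      (⋃ i ∈ Set.Icc 1 n, ⋃ j ∈ Set.Icc 1 n, ⋃ (_ : i ≠ j),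
        (fun c : ℝ × ℝ => toR2 (γ i + γ j) + c) '' C)) :
    Set.extremePoints ℝ N =
      {p : ℝ × ℝ | ∃ i : ℕ, 1 ≤ i ∧ i ≤ n - 1 ∧ p = toR2 (γ i + γ (i + 1)) ∧
        (toR2 (γ i) ∈ Set.extremePoints ℝ Θ ∨
          toR2 (γ (i + 1)) ∈ Set.extremePoints ℝ Θ)} := by
  have hcast : ∀ v, toR2 v ∈ C ↔ InCone (γ 1) (γ n) v := toR2_mem_cone_iff hconvex hC
  have hgen' : ∀ v, v ∈ AddSubmonoid.closure
      {v : ℤ × ℤ | ∃ i : ℕ, 1 ≤ i ∧ i ≤ n ∧ v = γ i} ↔ InCone (γ 1) (γ n) v := by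
    intro v
    rw [← hcast, ← SetLike.mem_coe, hgen, Set.mem_ofPred_eq]
  have hcone : ∀ i, 1 ≤ i → i ≤ n → InCone (γ 1) (γ n) (γ i) := fun i => inCone_gen hgen'
  have hind : ∀ i, 1 ≤ i → i ≤ n → Indecomposable (γ 1) (γ n) (γ i) := fun i =>
    indecomposable_gen hconvex hgen' hmin
  have hpos : ∀ i j, 1 ≤ i → i < j → j ≤ n → 0 < det2 (γ i) (γ j) := fun i j =>
    det2_pos_of_lt hconvex hccw hcone
  have hone : ∀ i, 1 ≤ i → i + 1 ≤ n → det2 (γ i) (γ (i + 1)) = 1 := fun i =>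
    det2_consecutive_eq_one hconvex hgen' hind hpos
  have hrec : ∀ i, 1 ≤ i → i + 2 ≤ n →
      γ i + γ (i + 2) = det2 (γ i) (γ (i + 2)) • γ (i + 1) := fun i h1 hi =>
    add_eq_smul_of_det2_eq_one (hone i h1 (by omega)) (hone (i + 1) (by omega) hi)
  have htwo : ∀ i, 1 ≤ i → i + 2 ≤ n → 2 ≤ det2 (γ i) (γ (i + 2)) :=
    two_le_det2 hcone hind hpos hrec
  have hmid : ∀ i, 1 ≤ i → i + 2 ≤ n → ¬ 3 ≤ det2 (γ i) (γ (i + 2)) →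
      γ (i + 1) + γ (i + 1) = γ i + γ (i + 2) := by
    intro i h1 hi h3
    have h2 := htwo i h1 hi
    rw [hrec i h1 hi, show det2 (γ i) (γ (i + 2)) = 2 by omega, two_smul]
  have hΘmid : ∀ i, 1 ≤ i → i + 2 ≤ n → toR2 (γ (i + 1)) ∈ Set.extremePoints ℝ Θ →
      3 ≤ det2 (γ i) (γ (i + 2)) := by
    intro i h1 hi hext
    by_contra h3
    have hmemΘ : ∀ j, 1 ≤ j → j ≤ n → γ j ≠ 0 → toR2 (γ j) ∈ Θ := by
      intro j hj1 hj hj0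
      rw [hΘ]
      refine subset_convexHull ℝ _ ⟨⟨(hcast _).2 (hcone j hj1 hj), _, rfl⟩, fun h => hj0 ?_⟩
      exact toR2_injective (by rw [toR2_zero]; exact h)
    have hd := hpos i (i + 2) h1 (by omega) hi
    refine notMem_extremePoints_of_add_self_eq
      (hmemΘ i h1 (by omega) ?_) (hmemΘ (i + 2) (by omega) hi ?_) ?_ ?_ hext
    · intro h; rw [h, det2_zero_left] at hd; exact hd.false
    · intro h; rw [h, det2_zero_right] at hd; exact hd.false
    · intro h; rw [toR2_injective h, det2_self] at hd; exact hd.false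
    · rw [← toR2_add, ← toR2_add, hmid i h1 hi h3]
  have hmemN : ∀ i j, 1 ≤ i → i ≤ n → 1 ≤ j → j ≤ n → i ≠ j → ∀ c ∈ C,
      toR2 (γ i + γ j) + c ∈ N := by
    intro i j hi1 hi hj1 hj hij c hc
    rw [hN]
    refine subset_convexHull ℝ _ ?_
    simp only [Set.mem_iUnion]
    exact ⟨i, ⟨hi1, hi⟩, j, ⟨hj1, hj⟩, hij, c, hc, rfl⟩
  have hzero : (0 : ℝ × ℝ) ∈ C := by
    rw [← toR2_zero]; exact (hcast 0).2 InCone.zero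
  have hmemN' : ∀ i j, 1 ≤ i → i ≤ n → 1 ≤ j → j ≤ n → i ≠ j → toR2 (γ i + γ j) ∈ N := by
    intro i j hi1 hi hj1 hj hij
    simpa using hmemN i j hi1 hi hj1 hj hij 0 hzero
  have hfar : ∀ i j, 1 ≤ i → i + 2 ≤ j → j ≤ n →
      toR2 (γ i + γ j) ∉ Set.extremePoints ℝ N := by
    intro i j h1 hij hj
    obtain ⟨m, rfl⟩ : ∃ m, j = i + m + 2 := ⟨j - i - 2, by omega⟩
    have hc := cone_smul_mem hC
      ((hcast _).2 (inCone_increment_sub hcone hrec htwo h1 m hj)) (r := 1 / 2) (by norm_num)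
    refine notMem_extremePoints_of_add_self_eq
      (hmemN i (i + 1) h1 (by omega) (by omega) (by omega) (by omega) _ hc)
      (hmemN (i + m + 1) (i + m + 2) (by omega) (by omega) (by omega) hj (by omega) _ hc) ?_ ?_
    · intro h
      have h := congrArg (det2 (γ i)) (toR2_injective (add_right_cancel h))
      rw [det2_add_right, det2_add_right, det2_self, hone i h1 (by omega)] at h
      have := hpos i (i + m + 1) h1 (by omega) (by omega)
      have := hpos i (i + m + 2) h1 (by omega) (by omega)
      omega
    · simp only [toR2_add, toR2_sub]
      module
  ext x
  constructor
  · intro hx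
    have hxX := extremePoints_convexHull_subset (hN ▸ hx)
    simp only [Set.mem_iUnion] at hxX
    obtain ⟨i, ⟨hi1, hi⟩, j, ⟨hj1, hj⟩, hij, c, hc, rfl⟩ := hxX
    simp only at hx
    obtain rfl : c = 0 := by
      by_contra hc0
      refine notMem_extremePoints_of_add_self_eq (hmemN' i j hi1 hi hj1 hj hij)
        (hmemN i j hi1 hi hj1 hj hij _ (cone_smul_mem hC hc (r := 2) (by norm_num))) ?_ ?_ hx
      · intro h; exact hc0 (by simpa using h)
      · module
    simp only [add_zero] at hx ⊢
    wlog hlt : i < j generalizing i j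
    · rw [add_comm] at hx ⊢
      exact this j hj1 hj i hi1 hi hij.symm hx (by omega)
    obtain rfl : j = i + 1 := by
      by_contra hne
      exact hfar i j hi1 (by omega) hj hx
    refine ⟨i, hi1, by omega, rfl, ?_⟩
    by_cases hl : i = 1 ∨ 3 ≤ det2 (γ (i - 1)) (γ (i - 1 + 2))
    · obtain ⟨α, β, h1, h2, h3⟩ := exists_functional_left hone hrec htwo hi1 hj hl
      left
      rw [hΘ]
      exact mem_extremePoints_theta (by omega) hconvex hgen' hcast hi1 hi h1 h2 h3
    by_cases hr : i + 1 = n ∨ 3 ≤ det2 (γ i) (γ (i + 2))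
    · obtain ⟨α, β, h1, h2, h3⟩ := exists_functional_right hone hrec htwo hi1 hj hr
      right
      rw [hΘ]
      exact mem_extremePoints_theta (by omega) hconvex hgen' hcast hj1 hj h2 h1
        (fun k hk1 hk hki hki' => h3 k hk1 hk hki' hki)
    push Not at hl hr
    exfalso
    obtain ⟨m, rfl⟩ : ∃ m, i = m + 1 := ⟨i - 1, by omega⟩
    have e1 := hmid m (by omega) (by omega) (by simpa using hl.2)
    have e2 := hmid (m + 1) hi1 (by omega) (by simpa using hr.2)
    refine notMem_extremePoints_of_add_self_eq
      (hmemN' m (m + 1) (by omega) (by omega) (by omega) (by omega) (by omega))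
      (hmemN' (m + 2) (m + 3) (by omega) (by omega) (by omega) (by omega) (by omega)) ?_ ?_ hx
    · intro h
      have h := congrArg (det2 (γ m)) (toR2_injective h)
      rw [det2_add_right, det2_add_right, det2_self, hone m (by omega) (by omega)] at h
      have := hpos m (m + 2) (by omega) (by omega) (by omega)
      have := hpos m (m + 3) (by omega) (by omega) (by omega)
      omega
    · rw [← toR2_add, ← toR2_add]
      congr 1
      calc γ (m + 1) + γ (m + 1 + 1) + (γ (m + 1) + γ (m + 1 + 1))
          = (γ (m + 1) + γ (m + 1)) + (γ (m + 1 + 1) + γ (m + 1 + 1)) := by abel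
        _ = (γ m + γ (m + 2)) + (γ (m + 1) + γ (m + 3)) := by rw [e1, e2]
        _ = γ m + γ (m + 1) + (γ (m + 2) + γ (m + 3)) := by abel
  · rintro ⟨i, h1, hi, rfl, hext⟩
    rw [hN]
    rcases hext with hext | hext
    · have hl : i = 1 ∨ 3 ≤ det2 (γ (i - 1)) (γ (i - 1 + 2)) := by
        by_cases h : i = 1
        · exact Or.inl h
        · right
          exact hΘmid (i - 1) (by omega) (by omega)
            (by rwa [show i - 1 + 1 = i by omega])
      obtain ⟨α, β, e1, e2, e3⟩ := exists_functional_left hone hrec htwo h1 (by omega) hl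
      exact mem_extremePoints_nash (by omega) hC h1 (by omega) (by omega) (by omega) e1 e2 e3
    · have hr : i + 1 = n ∨ 3 ≤ det2 (γ i) (γ (i + 2)) := by
        by_cases h : i + 1 = n
        · exact Or.inl h
        · exact Or.inr (hΘmid i h1 (by omega) hext)
      obtain ⟨α, β, e1, e2, e3⟩ := exists_functional_right hone hrec htwo h1 (by omega) hr
      rw [add_comm]
      exact mem_extremePoints_nash (by omega) hC (by omega) (by omega) h1 (by omega) e2 e1
        (fun k hk1 hk hki hki' => e3 k hk1 hk hki' hki)
end

section
/- Let i ≥ 4 be an even integer and define the six vectors in ℤ²: v₁ = (fib(i−3)−fib(i+1), fib(i−2)−fib(i+2)), v₂ = (fib(i−3)−fib(i−1), fib(i−2)−fib(i)), v₃ = (fib(i−1), fib(i)), v₄ = (fib(i+1), fib(i+2)), v₅ = (fib(i+3)−fib(i+1), fib(i+4)−fib(i+2)), v₆ = (fib(i+3)−fib(i−1), fib(i+4)−fib(i)). Then det(v_j v_{j+1}) = 1 for each 1 ≤ j ≤ 5, where det((x₁,y₁) (x₂,y₂)) = x₁y₂ − x₂y₁. -/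
def fibv₁ (i : ℕ) : ℤ × ℤ :=
  ((Nat.fib (i - 3) : ℤ) - Nat.fib (i + 1), (Nat.fib (i - 2) : ℤ) - Nat.fib (i + 2))
def fibv₂ (i : ℕ) : ℤ × ℤ :=
  ((Nat.fib (i - 3) : ℤ) - Nat.fib (i - 1), (Nat.fib (i - 2) : ℤ) - Nat.fib i)
def fibv₃ (i : ℕ) : ℤ × ℤ := ((Nat.fib (i - 1) : ℤ), (Nat.fib i : ℤ))
def fibv₄ (i : ℕ) : ℤ × ℤ := ((Nat.fib (i + 1) : ℤ), (Nat.fib (i + 2) : ℤ))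
def fibv₅ (i : ℕ) : ℤ × ℤ :=
  ((Nat.fib (i + 3) : ℤ) - Nat.fib (i + 1), (Nat.fib (i + 4) : ℤ) - Nat.fib (i + 2))
def fibv₆ (i : ℕ) : ℤ × ℤ :=
  ((Nat.fib (i + 3) : ℤ) - Nat.fib (i - 1), (Nat.fib (i + 4) : ℤ) - Nat.fib i)

/-- Cassini's identity at odd indices, as a quadratic form in two consecutive Fibonacci numbers. -/
theorem fib_odd_cassini (k : ℕ) :
    (Nat.fib (2 * k + 1) : ℤ) ^ 2 + Nat.fib (2 * k + 1) * Nat.fib (2 * k + 2)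
      - (Nat.fib (2 * k + 2) : ℤ) ^ 2 = 1 := by
  induction k with
  | zero => simp
  | succ k ih =>
    have h₃ : Nat.fib (2 * (k + 1) + 1) = Nat.fib (2 * k + 1) + Nat.fib (2 * k + 2) :=
      Nat.fib_add_two
    have h₄ : Nat.fib (2 * (k + 1) + 2) = Nat.fib (2 * k + 2) + Nat.fib (2 * (k + 1) + 1) :=
      Nat.fib_add_two
    rw [h₄, h₃]
    push_cast
    linear_combination ih

/-- The six vectors of Lemma `l fib` are consecutively unimodular. -/
theorem det_consecutive_eq_one (i : ℕ) (hi : 4 ≤ i) (hev : Even i) :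
    det2 (fibv₁ i) (fibv₂ i) = 1 ∧ det2 (fibv₂ i) (fibv₃ i) = 1 ∧
    det2 (fibv₃ i) (fibv₄ i) = 1 ∧ det2 (fibv₄ i) (fibv₅ i) = 1 ∧
    det2 (fibv₅ i) (fibv₆ i) = 1 := by
  obtain ⟨k, rfl⟩ : ∃ k, i = 2 * k + 4 := by
    obtain ⟨m, rfl⟩ := hev
    exact ⟨m - 2, by omega⟩
  have cassini := fib_odd_cassini k
  have fib_succ (n : ℕ) : (Nat.fib (n + 2) : ℤ) = Nat.fib n + Nat.fib (n + 1) := by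
    exact_mod_cast Nat.fib_add_two
  have h₃ := fib_succ (2 * k + 1)
  have h₄ := fib_succ (2 * k + 2)
  have h₅ := fib_succ (2 * k + 3)
  have h₆ := fib_succ (2 * k + 4)
  have h₇ := fib_succ (2 * k + 5)
  have h₈ := fib_succ (2 * k + 6)
  simp only [add_assoc, Nat.reduceAdd] at h₃ h₄ h₅ h₆ h₇ h₈
  simp only [det2, fibv₁, fibv₂, fibv₃, fibv₄, fibv₅, fibv₆, add_assoc, Nat.reduceAdd,
    show 2 * k + 4 - 3 = 2 * k + 1 by omega, show 2 * k + 4 - 2 = 2 * k + 2 by omega,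
    show 2 * k + 4 - 1 = 2 * k + 3 by omega, h₈, h₇, h₆, h₅, h₄, h₃]
  refine ⟨?_, ?_, ?_, ?_, ?_⟩ <;> linear_combination cassini
end

section
/- Let i ≥ 4 be an even integer and define the six vectors in ℤ²: v₁ = (fib(i−3)−fib(i+1), fib(i−2)−fib(i+2)), v₂ = (fib(i−3)−fib(i−1), fib(i−2)−fib(i)), v₃ = (fib(i−1), fib(i)), v₄ = (fib(i+1), fib(i+2)), v₅ = (fib(i+3)−fib(i+1), fib(i+4)−fib(i+2)), v₆ = (fib(i+3)−fib(i−1), fib(i+4)−fib(i)). Then the integral points of the closed segment in ℝ² joining v₁ and v₆ are exactly {v₁, v₂, v₃, v₄, v₅, v₆}; that is, for every w ∈ ℤ², the point w (viewed in ℝ²) lies in segment ℝ from v₁ to v₆ if and only if w ∈ {v₁,…,v₆}. -/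
/-- The integral points of a segment whose direction is `N` times a primitive vector `(p, q)`
are the `N + 1` equally spaced ones. -/
theorem toR2_mem_segment_iff_of_isCoprime {p q : ℤ} (hp : 0 < p) (hpq : IsCoprime p q)
    {N : ℤ} (hN : 0 < N) (v w : ℤ × ℤ) :
    toR2 w ∈ segment ℝ (toR2 v) (toR2 (v.1 + N * p, v.2 + N * q)) ↔
      ∃ k : ℤ, 0 ≤ k ∧ k ≤ N ∧ w = (v.1 + k * p, v.2 + k * q) := by
  have hpR : (0 : ℝ) < p := by exact_mod_cast hp
  have hNR : (0 : ℝ) < N := by exact_mod_cast hN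
  obtain ⟨w₁, w₂⟩ := w
  obtain ⟨v₁, v₂⟩ := v
  rw [segment_eq_image']
  simp only [toR2, Set.mem_image, Set.mem_Icc, Prod.ext_iff, Prod.fst_add, Prod.snd_add,
    Prod.smul_fst, Prod.smul_snd, Prod.fst_sub, Prod.snd_sub, smul_eq_mul]
  push_cast
  constructor
  · rintro ⟨t, ⟨ht0, ht1⟩, h1, h2⟩
    have hcross : p * (w₂ - v₂) = q * (w₁ - v₁) := by
      have : (p : ℝ) * (w₂ - v₂) = q * (w₁ - v₁) := by
        rw [← h1, ← h2]; ring
      exact_mod_cast this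
    obtain ⟨k, hk⟩ := hpq.dvd_of_dvd_mul_left (Dvd.intro _ hcross)
    have hkt : (k : ℝ) = t * N := by
      have hkR : (w₁ : ℝ) - v₁ = p * k := by exact_mod_cast hk
      apply mul_left_cancel₀ hpR.ne'
      linear_combination -hkR - h1
    refine ⟨k, ?_, ?_, by linear_combination hk, ?_⟩
    · have : (0 : ℝ) ≤ k := hkt ▸ mul_nonneg ht0 hNR.le
      exact_mod_cast this
    · have : (k : ℝ) ≤ N := hkt ▸ mul_le_of_le_one_left hNR.le ht1
      exact_mod_cast this
    · apply mul_left_cancel₀ hp.ne'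
      linear_combination hcross + q * hk
  · rintro ⟨k, hk0, hkN, rfl, rfl⟩
    have hk0R : (0 : ℝ) ≤ k := by exact_mod_cast hk0
    have hkNR : (k : ℝ) ≤ N := by exact_mod_cast hkN
    refine ⟨k / N, ⟨by positivity, (div_le_one hNR).2 hkNR⟩, ?_, ?_⟩ <;>
    · push_cast
      field_simp
      ring

/-- The integral points of the segment `[v₁, v₆]` are exactly `{v₁, …, v₆}`. -/
theorem segment_integral_points (i : ℕ) (hi : 4 ≤ i) (hev : Even i) :
    ∀ w : ℤ × ℤ,
      toR2 w ∈ segment ℝ (toR2 (fibv₁ i)) (toR2 (fibv₆ i)) ↔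
        w ∈ ({fibv₁ i, fibv₂ i, fibv₃ i, fibv₄ i, fibv₅ i, fibv₆ i} : Set (ℤ × ℤ)) := by
  obtain ⟨n, rfl⟩ := Nat.exists_eq_add_of_le' hi
  intro w
  have hp : (0 : ℤ) < Nat.fib (n + 4) := by exact_mod_cast Nat.fib_pos.2 (by lia)
  have hpq : IsCoprime (Nat.fib (n + 4) : ℤ) (Nat.fib (n + 5)) :=
    Nat.isCoprime_iff_coprime.2 (Nat.fib_coprime_fib_succ (n + 4))
  have f3 : Nat.fib (n + 3) = Nat.fib (n + 1) + Nat.fib (n + 2) := Nat.fib_add_two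
  have f4 : Nat.fib (n + 4) = Nat.fib (n + 2) + Nat.fib (n + 3) := Nat.fib_add_two
  have f5 : Nat.fib (n + 5) = Nat.fib (n + 3) + Nat.fib (n + 4) := Nat.fib_add_two
  have f6 : Nat.fib (n + 6) = Nat.fib (n + 4) + Nat.fib (n + 5) := Nat.fib_add_two
  have f7 : Nat.fib (n + 7) = Nat.fib (n + 5) + Nat.fib (n + 6) := Nat.fib_add_two
  have f8 : Nat.fib (n + 8) = Nat.fib (n + 6) + Nat.fib (n + 7) := Nat.fib_add_two
  have e1 : n + 4 - 3 = n + 1 := by lia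
  have e2 : n + 4 - 2 = n + 2 := by lia
  have e3 : n + 4 - 1 = n + 3 := by lia
  have h6 : fibv₆ (n + 4) = ((fibv₁ (n + 4)).1 + 5 * (Nat.fib (n + 4) : ℤ),
      (fibv₁ (n + 4)).2 + 5 * (Nat.fib (n + 5) : ℤ)) := by
    simp only [fibv₁, fibv₆, e1, e2, e3, Prod.mk.injEq]
    lia
  rw [h6, toR2_mem_segment_iff_of_isCoprime hp hpq (by norm_num), ← h6]
  obtain ⟨x, y⟩ := w
  simp only [fibv₁, fibv₂, fibv₃, fibv₄, fibv₅, fibv₆, e1, e2, e3, Set.mem_insert_iff,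
    Set.mem_singleton_iff, Prod.mk.injEq]
  constructor
  · rintro ⟨k, hk0, hk5, hx, hy⟩
    interval_cases k <;> lia
  · rintro (h | h | h | h | h | h)
    · exact ⟨0, by lia⟩
    · exact ⟨1, by lia⟩
    · exact ⟨2, by lia⟩
    · exact ⟨3, by lia⟩
    · exact ⟨4, by lia⟩
    · exact ⟨5, by lia⟩
end

section
/- Let l ≥ 4 be an even integer and let C = {s·(1,0) + t·(fib(l−1), fib(l)) : s, t ∈ ℝ, s, t ≥ 0} ⊆ ℝ². Let Γ = {(1,0)} ∪ {(fib(2j−1), fib(2j)) : 1 ≤ j ≤ l/2} ⊆ ℤ². Then (a) the additive submonoid of ℤ² generated by Γ equals {v ∈ ℤ² : v ∈ C} (so Γ generates the full semigroup C ∩ ℤ²), and (b) Γ is a minimal generating set: no element g ∈ Γ lies in the additive submonoid generated by Γ \ {g}. -/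
/-- The vectors `(fib(2j−1), fib(2j))`, with the convention `fib(−1) = 1` at `j = 0`. -/
def fibVec (j : ℕ) : ℤ × ℤ := ((Nat.fib (2 * j + 1) : ℤ) - Nat.fib (2 * j), (Nat.fib (2 * j) : ℤ))

theorem fibVec_zero : fibVec 0 = (1, 0) := by simp [fibVec]

theorem fibVec_succ (j : ℕ) :
    fibVec (j + 1) = ((fibVec j).1 + (fibVec j).2, (fibVec j).1 + 2 * (fibVec j).2) := by
  have h2 : Nat.fib (2 * (j + 1)) = Nat.fib (2 * j) + Nat.fib (2 * j + 1) := Nat.fib_add_two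
  have h3 : Nat.fib (2 * (j + 1) + 1) = Nat.fib (2 * j + 1) + Nat.fib (2 * (j + 1)) :=
    Nat.fib_add_two
  simp only [fibVec, h3, h2]
  push_cast
  ext <;> ring

theorem fibVec_of_one_le {j : ℕ} (hj : 1 ≤ j) :
    fibVec j = ((Nat.fib (2 * j - 1) : ℤ), (Nat.fib (2 * j) : ℤ)) := by
  obtain ⟨k, rfl⟩ := Nat.exists_eq_add_of_le' hj
  have h : Nat.fib (2 * (k + 1) + 1) = Nat.fib (2 * (k + 1) - 1) + Nat.fib (2 * (k + 1)) :=
    Nat.fib_add_two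
  simp [fibVec, h]

theorem fibVec_nonneg (j : ℕ) : 0 ≤ (fibVec j).1 ∧ 0 ≤ (fibVec j).2 := by
  induction j with
  | zero => simp [fibVec_zero]
  | succ j ih =>
    rw [fibVec_succ]
    constructor <;> linarith [ih.1, ih.2]

theorem fibVec_norm (j : ℕ) :
    (fibVec j).1 ^ 2 + (fibVec j).1 * (fibVec j).2 - (fibVec j).2 ^ 2 = 1 := by
  induction j with
  | zero => simp [fibVec_zero]
  | succ j ih =>
    rw [fibVec_succ]
    linear_combination ih

/-- Twice the polar form of the quadratic form `x ^ 2 + x * y - y ^ 2`. -/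
def fibForm (v w : ℤ × ℤ) : ℤ := 2 * v.1 * w.1 + v.1 * w.2 + v.2 * w.1 - 2 * v.2 * w.2

theorem fibForm_comm (v w : ℤ × ℤ) : fibForm v w = fibForm w v := by
  simp only [fibForm]
  ring

theorem fibForm_fibVec_self (i : ℕ) : fibForm (fibVec i) (fibVec i) = 2 := by
  simp only [fibForm]
  linear_combination 2 * fibVec_norm i

theorem fibForm_fibVec_add (i k : ℕ) :
    2 ≤ fibForm (fibVec i) (fibVec (i + k)) ∧
      fibForm (fibVec i) (fibVec (i + k)) + 1 ≤ fibForm (fibVec i) (fibVec (i + (k + 1))) := by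
  induction k with
  | zero =>
    have h := fibForm_fibVec_self i
    refine ⟨h.ge, ?_⟩
    simp only [zero_add, add_zero, h, fibVec_succ]
    simp only [fibForm]
    linarith [fibVec_norm i]
  | succ k ih =>
    refine ⟨by linarith [ih.1, ih.2], ?_⟩
    have h : fibForm (fibVec i) (fibVec (i + (k + 1 + 1))) =
        3 * fibForm (fibVec i) (fibVec (i + (k + 1))) - fibForm (fibVec i) (fibVec (i + k)) := by
      simp only [← add_assoc, fibVec_succ]
      simp only [fibForm]
      ring
    linarith [ih.1, ih.2]

theorem three_le_fibForm_of_lt {i j : ℕ} (h : i < j) : 3 ≤ fibForm (fibVec i) (fibVec j) := by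
  obtain ⟨k, rfl⟩ := Nat.exists_eq_add_of_lt h
  have := fibForm_fibVec_add i k
  rw [add_assoc]
  linarith [this.1, this.2]

theorem three_le_fibForm_of_ne {i j : ℕ} (h : i ≠ j) : 3 ≤ fibForm (fibVec i) (fibVec j) := by
  rcases h.lt_or_gt with h | h
  · exact three_le_fibForm_of_lt h
  · exact fibForm_comm _ _ ▸ three_le_fibForm_of_lt h

/-- Each `fibVec j` with `j ≤ m` lies on or below the ray through `fibVec m`. -/
theorem fibVec_det_nonneg {j m : ℕ} (h : j ≤ m) :
    0 ≤ (fibVec j).1 * (fibVec m).2 - (fibVec j).2 * (fibVec m).1 := by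
  obtain ⟨k, rfl⟩ := Nat.exists_eq_add_of_le h
  let d (k : ℕ) : ℤ := (fibVec j).1 * (fibVec (j + k)).2 - (fibVec j).2 * (fibVec (j + k)).1
  suffices H : 0 ≤ d k ∧ d k ≤ d (k + 1) from H.1
  clear h
  induction k with
  | zero =>
    simp only [d, zero_add, add_zero, fibVec_succ]
    constructor <;> linarith [fibVec_norm j]
  | succ k ih =>
    have h : d (k + 1 + 1) = 3 * d (k + 1) - d k := by
      simp only [d, ← add_assoc, fibVec_succ]
      ring
    constructor <;> linarith [ih.1, ih.2]

theorem zsmul_mem_of_nonneg {G : Type*} [AddGroup G] {S : AddSubmonoid G} {v : G} (hv : v ∈ S)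
    {c : ℤ} (hc : 0 ≤ c) : c • v ∈ S := by
  lift c to ℕ using hc
  rw [natCast_zsmul]
  exact nsmul_mem hv c

theorem mem_closure_fibVec (m : ℕ) {x y : ℤ} (hx : 0 ≤ x) (hy : 0 ≤ y)
    (h : 0 ≤ x * (fibVec m).2 - y * (fibVec m).1) :
    (x, y) ∈ AddSubmonoid.closure (fibVec '' Set.Iic m) := by
  have smul_mem {n j : ℕ} {c : ℤ} (hc : 0 ≤ c) (hj : j ≤ n) :
      c • fibVec j ∈ AddSubmonoid.closure (fibVec '' Set.Iic n) :=
    zsmul_mem_of_nonneg (AddSubmonoid.subset_closure (Set.mem_image_of_mem _ (Set.mem_Iic.2 hj))) hc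
  induction m with
  | zero =>
    obtain rfl : y = 0 := by
      simp only [fibVec_zero] at h
      linarith
    convert smul_mem hx (le_refl 0) using 1
    rw [fibVec_zero, Prod.smul_mk, smul_zero, smul_eq_mul, mul_one]
  | succ m ih =>
    rcases le_or_gt 0 (x * (fibVec m).2 - y * (fibVec m).1) with h' | h'
    · exact AddSubmonoid.closure_mono (Set.image_mono (Set.Iic_subset_Iic.2 m.le_succ)) (ih h')
    · have hq : 0 ≤ y * (fibVec m).1 - x * (fibVec m).2 := by linarith
      convert add_mem (smul_mem h m.le_succ) (smul_mem hq le_rfl) using 1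
      rw [fibVec_succ]
      ext
      · simp only [Prod.fst_add, Prod.smul_fst, smul_eq_mul]
        linear_combination (-x) * fibVec_norm m
      · simp only [Prod.snd_add, Prod.smul_snd, smul_eq_mul]
        linear_combination (-y) * fibVec_norm m

theorem mem_closure_fibVec_iff (m : ℕ) (v : ℤ × ℤ) :
    v ∈ AddSubmonoid.closure (fibVec '' Set.Iic m) ↔
      0 ≤ v.1 ∧ 0 ≤ v.2 ∧ 0 ≤ v.1 * (fibVec m).2 - v.2 * (fibVec m).1 := by
  refine ⟨fun hv ↦ ?_, fun ⟨hx, hy, h⟩ ↦ mem_closure_fibVec m hx hy h⟩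
  induction hv using AddSubmonoid.closure_induction with
  | mem w hw =>
    obtain ⟨j, hj, rfl⟩ := hw
    exact ⟨(fibVec_nonneg j).1, (fibVec_nonneg j).2, fibVec_det_nonneg hj⟩
  | zero => simp
  | add v w _ _ hv hw =>
    simp only [Prod.fst_add, Prod.snd_add]
    refine ⟨by linarith [hv.1, hw.1], by linarith [hv.2.1, hw.2.1], ?_⟩
    linarith [hv.2.2, hw.2.2]

theorem fibVec_notMem_closure (i : ℕ) {s : Set (ℤ × ℤ)} (hs : s ⊆ Set.range fibVec \ {fibVec i}) :
    fibVec i ∉ AddSubmonoid.closure s := by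
  have key (w) (hw : w ∈ AddSubmonoid.closure s) :
      fibForm (fibVec i) w = 0 ∨ 3 ≤ fibForm (fibVec i) w := by
    induction hw using AddSubmonoid.closure_induction with
    | mem w hw =>
      obtain ⟨⟨j, rfl⟩, hj⟩ := hs hw
      exact .inr (three_le_fibForm_of_ne fun hij ↦ hj (by simp [hij]))
    | zero => simp [fibForm]
    | add v w _ _ hv hw =>
      have : fibForm (fibVec i) (v + w) = fibForm (fibVec i) v + fibForm (fibVec i) w := by
        simp only [fibForm, Prod.fst_add, Prod.snd_add]
        ring
      omega
  intro h
  have := key _ h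
  rw [fibForm_fibVec_self] at this
  omega

/-- A real cone spanned by `(1, 0)` and `(a, b)`, described by linear inequalities. -/
theorem exists_cone_combination_iff {a b x y : ℝ} (ha : 0 ≤ a) (hb : 0 < b) :
    (∃ s t : ℝ, 0 ≤ s ∧ 0 ≤ t ∧ (x, y) = s • ((1 : ℝ), (0 : ℝ)) + t • (a, b)) ↔
      0 ≤ x ∧ 0 ≤ y ∧ 0 ≤ x * b - y * a := by
  constructor
  · rintro ⟨s, t, hs, ht, h⟩
    simp only [Prod.smul_mk, smul_eq_mul, Prod.mk_add_mk, Prod.mk.injEq, mul_one, mul_zero,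
      zero_add] at h
    obtain ⟨rfl, rfl⟩ := h
    refine ⟨by positivity, by positivity, ?_⟩
    have : 0 ≤ s * b := by positivity
    linarith
  · rintro ⟨-, hy, h⟩
    refine ⟨(x * b - y * a) / b, y / b, by positivity, by positivity, ?_⟩
    ext <;> simp
    · field_simp
      ring
    · field_simp

/-- The Fibonacci generators `{(1,0)} ∪ {(fib(2j−1), fib(2j)) : 1 ≤ j ≤ l/2}` form the
minimal generating set of the semigroup of integral points of the cone spanned by
`(1,0)` and `(fib(l−1), fib(l))`. -/
theorem fib_minimal_generating_set (l : ℕ) (hl : 4 ≤ l) (hev : Even l)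
    (C : Set (ℝ × ℝ))
    (hC : C = {p : ℝ × ℝ | ∃ s t : ℝ, 0 ≤ s ∧ 0 ≤ t ∧
      p = s • ((1 : ℝ), (0 : ℝ)) + t • ((Nat.fib (l - 1) : ℝ), (Nat.fib l : ℝ))})
    (Γ : Set (ℤ × ℤ))
    (hΓ : Γ = {((1 : ℤ), (0 : ℤ))} ∪
      {v : ℤ × ℤ | ∃ j : ℕ, 1 ≤ j ∧ j ≤ l / 2 ∧
        v = ((Nat.fib (2 * j - 1) : ℤ), (Nat.fib (2 * j) : ℤ))}) :
    (AddSubmonoid.closure Γ : Set (ℤ × ℤ)) =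
      {v : ℤ × ℤ | ((v.1 : ℝ), (v.2 : ℝ)) ∈ C} ∧
    ∀ g ∈ Γ, g ∉ AddSubmonoid.closure (Γ \ {g}) := by
  have hΓ' : Γ = fibVec '' Set.Iic (l / 2) := by
    rw [hΓ]
    ext v
    simp only [Set.mem_union, Set.mem_singleton_iff, Set.mem_ofPred_eq, Set.mem_image, Set.mem_Iic]
    constructor
    · rintro (rfl | ⟨j, hj, hjl, rfl⟩)
      · exact ⟨0, Nat.zero_le _, fibVec_zero⟩
      · exact ⟨j, hjl, fibVec_of_one_le hj⟩
    · rintro ⟨j, hjl, rfl⟩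
      rcases Nat.eq_zero_or_pos j with rfl | hj
      · exact .inl fibVec_zero
      · exact .inr ⟨j, hj, hjl, fibVec_of_one_le hj⟩
  subst hΓ'
  constructor
  · ext v
    have hb : (0 : ℝ) < Nat.fib l := by
      exact_mod_cast Nat.fib_pos.2 (by omega)
    rw [SetLike.mem_coe, mem_closure_fibVec_iff, hC, Set.mem_ofPred_eq, Set.mem_ofPred_eq,
      exists_cone_combination_iff (Nat.cast_nonneg _) hb, fibVec_of_one_le (by omega),
      Nat.two_mul_div_two_of_even hev]
    norm_cast
  · rintro _ ⟨i, -, rfl⟩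
    exact fibVec_notMem_closure i (Set.sdiff_subset_sdiff_left (Set.image_subset_range _ _))
end

section
/- Inverse of the continued fraction [1,2,…,2,x,2,…,2]: define eval : List ℚ → ℚ by eval L = foldr (a, r ↦ a − 1/r) 0 over L (with the convention 1/0 = 0, so eval [a] = a and eval (a :: L) = a − 1/(eval L)). (a) For all integers n, m, x with n ≥ 2, m ≥ n, x ≥ 3: letting P = [1] ++ replicate (n−2) 2 ++ [x] ++ replicate (m−n) 2 and Q = [n] ++ replicate (x−3) 2 ++ [m−n+2] (lists of rationals), one has eval P · eval Q = 1; in particular eval Q = (eval P)⁻¹ and Q has length x−1. (b) For all integers n ≥ 2: eval([1] ++ replicate (n−1) 2) = 1/n, and hence eval([n]) = n is its inverse (the case x = 2, m = n). -/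
/-- Evaluation of a minus (Hirzebruch–Jung) continued fraction `[a₁,…,a_s]`,
with the convention `1/0 = 0`, so `eval [a] = a` and `eval (a :: L) = a − 1/(eval L)`. -/
def evalCF (L : List ℚ) : ℚ := L.foldr (fun a r => a - 1 / r) 0

theorem evalCF_cons (a : ℚ) (L : List ℚ) : evalCF (a :: L) = a - 1 / evalCF L := rfl

theorem evalCF_replicate_two (k : ℕ) :
    evalCF (List.replicate k (2 : ℚ)) = ((k : ℚ) + 1) / k := by
  induction k with
  | zero => simp [evalCF]
  | succ k ih =>
    have h : (k : ℚ) + 1 ≠ 0 := by positivity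
    rw [List.replicate_succ, evalCF_cons, ih, one_div_div]
    push_cast
    field_simp
    ring

theorem evalCF_replicate_two_append (k : ℕ) (L : List ℚ) {s : ℚ} (hs : 0 < s)
    (hL : evalCF L = s + 1) :
    evalCF (List.replicate k (2 : ℚ) ++ L) = ((k + 1) * s + 1) / (k * s + 1) := by
  induction k with
  | zero => simp [hL]
  | succ k ih =>
    have h : ((k : ℚ) + 1) * s + 1 ≠ 0 := by positivity
    rw [List.replicate_succ, List.cons_append, evalCF_cons, ih, one_div_div]
    push_cast
    field_simp
    ring

theorem evalCF_cons_replicate_two_append (a : ℚ) (k : ℕ) (L : List ℚ) {s : ℚ} (hs : 0 < s)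
    (hL : evalCF L = s + 1) :
    evalCF (a :: (List.replicate k (2 : ℚ) ++ L)) = a - 1 + s / ((k + 1) * s + 1) := by
  have h : ((k : ℚ) + 1) * s + 1 ≠ 0 := by positivity
  rw [evalCF_cons, evalCF_replicate_two_append k L hs hL, one_div_div]
  field_simp
  ring

/-- The inverse of the minus continued fraction `[1,2,…,2,x,2,…,2]` (with `x` in position
`n` and total length `m`) is `[n,2,…,2,m−n+2]`, of length `x−1`; and the case `x = 2`:
`[1,2,…,2]` of length `n` evaluates to `1/n`, whose inverse is `[n]`. -/
theorem inverse_continued_fraction :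
    (∀ n m x : ℕ, 2 ≤ n → n ≤ m → 3 ≤ x →
      evalCF ([(1 : ℚ)] ++ List.replicate (n - 2) (2 : ℚ) ++ [(x : ℚ)] ++
          List.replicate (m - n) (2 : ℚ)) *
        evalCF ([(n : ℚ)] ++ List.replicate (x - 3) (2 : ℚ) ++ [(m : ℚ) - (n : ℚ) + 2]) = 1 ∧
      evalCF ([(n : ℚ)] ++ List.replicate (x - 3) (2 : ℚ) ++ [(m : ℚ) - (n : ℚ) + 2]) =
        (evalCF ([(1 : ℚ)] ++ List.replicate (n - 2) (2 : ℚ) ++ [(x : ℚ)] ++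
          List.replicate (m - n) (2 : ℚ)))⁻¹ ∧
      ([(n : ℚ)] ++ List.replicate (x - 3) (2 : ℚ) ++ [(m : ℚ) - (n : ℚ) + 2]).length
        = x - 1) ∧
    (∀ n : ℕ, 2 ≤ n →
      evalCF ([(1 : ℚ)] ++ List.replicate (n - 1) (2 : ℚ)) = 1 / (n : ℚ) ∧
      evalCF [(n : ℚ)] = (n : ℚ)) := by
  refine ⟨fun n m x hn hm hx => ?_, fun n hn => ⟨?_, by simp [evalCF]⟩⟩
  · obtain ⟨j, rfl⟩ := Nat.exists_eq_add_of_le hn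
    obtain ⟨k, rfl⟩ := Nat.exists_eq_add_of_le hm
    obtain ⟨i, rfl⟩ := Nat.exists_eq_add_of_le hx
    have hk : (0 : ℚ) < k + 1 := by positivity
    have hs : (0 : ℚ) < i + 1 + 1 / (k + 1) := by positivity
    have hx_tail : evalCF (((3 + i : ℕ) : ℚ) :: List.replicate k (2 : ℚ)) =
        (i + 1 + 1 / (k + 1)) + 1 := by
      rw [evalCF_cons, evalCF_replicate_two, one_div_div]
      push_cast
      field_simp
      ring
    have hlast : evalCF [((2 + j + k : ℕ) : ℚ) - ((2 + j : ℕ) : ℚ) + 2] = (k + 1) + 1 := by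
      simp only [evalCF, List.foldr_cons, List.foldr_nil]
      push_cast
      ring
    have hmul : evalCF ([(1 : ℚ)] ++ List.replicate (2 + j - 2) (2 : ℚ) ++ [((3 + i : ℕ) : ℚ)] ++
          List.replicate (2 + j + k - (2 + j)) (2 : ℚ)) *
        evalCF ([((2 + j : ℕ) : ℚ)] ++ List.replicate (3 + i - 3) (2 : ℚ) ++
          [((2 + j + k : ℕ) : ℚ) - ((2 + j : ℕ) : ℚ) + 2]) = 1 := by
      simp only [Nat.add_sub_cancel_left, List.append_assoc, List.cons_append,
        List.nil_append]
      rw [evalCF_cons_replicate_two_append _ _ _ hs hx_tail,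
        evalCF_cons_replicate_two_append _ _ _ hk hlast]
      push_cast
      field_simp
      ring
    exact ⟨hmul, eq_inv_of_mul_eq_one_right hmul, by simp; omega⟩
  · obtain ⟨k, rfl⟩ := Nat.exists_eq_add_of_le' (Nat.one_le_of_lt hn)
    have h : (k : ℚ) + 1 ≠ 0 := by positivity
    rw [List.singleton_append, evalCF_cons, evalCF_replicate_two, one_div_div,
      Nat.add_sub_cancel]
    push_cast
    field_simp
    ring
end

section
/- Inverse continued fraction of the Fibonacci toric surface: define eval : List ℚ → ℚ by eval L = foldr (a, r ↦ a − 1/r) 0 over L (with the convention 1/0 = 0, so eval [a] = a and eval (a :: L) = a − 1/(eval L)). Then for every integer n ≥ 2, eval((2 : ℚ) :: (replicate (n−2) 3 ++ [2])) = fib(2n)/fib(2n−1); that is, the minus continued fraction [2,3,…,3,2] of length n evaluates to fib(2n)/fib(2n−1). -/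
/-- The minus continued fraction `[3,…,3,2]` with `k` threes is `fib(2k+3)/fib(2k+1)`. -/
theorem evalCF_replicate_three_append_two (k : ℕ) :
    evalCF (List.replicate k (3 : ℚ) ++ [(2 : ℚ)]) =
      (Nat.fib (2 * k + 3) : ℚ) / (Nat.fib (2 * k + 1) : ℚ) := by
  induction k with
  | zero => norm_num [evalCF, Nat.fib_add_two]
  | succ k ih =>
    rw [List.replicate_succ, List.cons_append, evalCF_cons, ih, one_div_div,
      show 2 * (k + 1) + 3 = 2 * k + 5 by ring, show 2 * (k + 1) + 1 = 2 * k + 3 by ring]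
    have h : (Nat.fib (2 * k + 3) : ℚ) ≠ 0 := by
      exact_mod_cast (Nat.fib_pos.2 (by omega)).ne'
    have h₃ : Nat.fib (2 * k + 3) = Nat.fib (2 * k + 1) + Nat.fib (2 * k + 2) := Nat.fib_add_two
    have h₄ : Nat.fib (2 * k + 4) = Nat.fib (2 * k + 2) + Nat.fib (2 * k + 3) := Nat.fib_add_two
    have h₅ : Nat.fib (2 * k + 5) = Nat.fib (2 * k + 3) + Nat.fib (2 * k + 4) := Nat.fib_add_two
    rw [eq_div_iff h, sub_mul, div_mul_cancel₀ _ h, sub_eq_iff_eq_add]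
    norm_cast
    omega

/-- The minus continued fraction `[2,3,…,3,2]` of length `n` evaluates to
`fib(2n)/fib(2n−1)`. -/
theorem fib_inverse_continued_fraction (n : ℕ) (hn : 2 ≤ n) :
    evalCF ((2 : ℚ) :: (List.replicate (n - 2) (3 : ℚ) ++ [(2 : ℚ)])) =
      (Nat.fib (2 * n) : ℚ) / (Nat.fib (2 * n - 1) : ℚ) := by
  obtain ⟨k, rfl⟩ := Nat.exists_eq_add_of_le' hn
  rw [Nat.add_sub_cancel, evalCF_cons, evalCF_replicate_three_append_two, one_div_div,
    show 2 * (k + 2) - 1 = 2 * k + 3 by omega, show 2 * (k + 2) = 2 * k + 4 by ring]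
  have h : (Nat.fib (2 * k + 3) : ℚ) ≠ 0 := by
    exact_mod_cast (Nat.fib_pos.2 (by omega)).ne'
  have h₃ : Nat.fib (2 * k + 3) = Nat.fib (2 * k + 1) + Nat.fib (2 * k + 2) := Nat.fib_add_two
  have h₄ : Nat.fib (2 * k + 4) = Nat.fib (2 * k + 2) + Nat.fib (2 * k + 3) := Nat.fib_add_two
  rw [eq_div_iff h, sub_mul, div_mul_cancel₀ _ h, sub_eq_iff_eq_add]
  norm_cast
  omega
end

section
/- Nash blowup charts of the one-segment toric surface are smooth (combinatorial form): let k ≥ 2 be an integer. (a) The additive submonoid of ℤ² generated by {(1,0),(1,1)} ∪ {(0,j) : 1 ≤ j ≤ k} equals the additive submonoid generated by {(1,0),(0,1)} (i.e., it is all of ℕ², a free monoid on a basis of ℤ²). (b) The additive submonoid of ℤ² generated by {(1,k−1),(1,k)} ∪ {(0,−j) : 1 ≤ j ≤ k} equals the additive submonoid generated by {(1,k),(0,−1)}, and (1,k), (0,−1) form a ℤ-basis of ℤ². -/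
/-- Adjoining `a + b` and the multiples `2 • b, …, k • b` to a generating pair `a, b` does not
change the generated submonoid. -/
theorem AddSubmonoid.closure_pair_union_nsmul {M : Type*} [AddCommMonoid M] (a b : M) {k : ℕ}
    (hk : 1 ≤ k) :
    closure ({a, a + b} ∪ {v : M | ∃ j : ℕ, 1 ≤ j ∧ j ≤ k ∧ v = j • b}) = closure {a, b} := by
  have ha : a ∈ closure ({a, b} : Set M) := subset_closure (by simp)
  have hb : b ∈ closure ({a, b} : Set M) := subset_closure (by simp)
  apply le_antisymm <;> rw [closure_le]
  · rintro v ((rfl | rfl) | ⟨j, -, -, rfl⟩)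
    · exact ha
    · exact add_mem ha hb
    · exact nsmul_mem hb j
  · rintro v (rfl | rfl)
    · exact subset_closure (by simp)
    · exact subset_closure (Or.inr ⟨1, le_rfl, hk, (one_nsmul _).symm⟩)

/-- The chart semigroups of the Nash blowup of the one-segment toric surface
`Γ = {(1,0),(1,1),…,(1,k)}` are free: the first chart is generated by `(1,0),(0,1)`
and the last chart by `(1,k),(0,−1)`, which form a ℤ-basis of `ℤ²`. -/
theorem one_segment_nash_charts_smooth (k : ℕ) (hk : 2 ≤ k) :
    (AddSubmonoid.closure
        (({((1 : ℤ), (0 : ℤ)), ((1 : ℤ), (1 : ℤ))} : Set (ℤ × ℤ)) ∪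
          {v : ℤ × ℤ | ∃ j : ℕ, 1 ≤ j ∧ j ≤ k ∧ v = ((0 : ℤ), (j : ℤ))}) =
      AddSubmonoid.closure ({((1 : ℤ), (0 : ℤ)), ((0 : ℤ), (1 : ℤ))} : Set (ℤ × ℤ))) ∧
    (AddSubmonoid.closure
        (({((1 : ℤ), (k : ℤ) - 1), ((1 : ℤ), (k : ℤ))} : Set (ℤ × ℤ)) ∪
          {v : ℤ × ℤ | ∃ j : ℕ, 1 ≤ j ∧ j ≤ k ∧ v = ((0 : ℤ), -(j : ℤ))}) =
      AddSubmonoid.closure ({((1 : ℤ), (k : ℤ)), ((0 : ℤ), (-1 : ℤ))} : Set (ℤ × ℤ))) ∧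
    ((1 : ℤ) * (-1 : ℤ) - (0 : ℤ) * (k : ℤ) = 1 ∨
      (1 : ℤ) * (-1 : ℤ) - (0 : ℤ) * (k : ℤ) = -1) := by
  have h_one : 1 ≤ k := by lia
  refine ⟨?_, ?_, Or.inr (by norm_num)⟩
  · simpa using AddSubmonoid.closure_pair_union_nsmul ((1 : ℤ), (0 : ℤ)) ((0 : ℤ), (1 : ℤ)) h_one
  · rw [Set.pair_comm]
    simpa [← sub_eq_add_neg] using
      AddSubmonoid.closure_pair_union_nsmul ((1 : ℤ), (k : ℤ)) ((0 : ℤ), (-1 : ℤ)) h_one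
end

section
/- Middle Nash blowup chart of the two-segment normal toric surface: let k ≥ 2, m ≥ 2, a ≥ 1 be integers and set b = a·k + 1. Then the additive submonoid of ℤ² generated by the set {(1,k−1),(1,k)} ∪ {(0,−j) : 1 ≤ j ≤ k} ∪ {(j·a, j·b) : 1 ≤ j ≤ m} ∪ {(j·a, 1 + j·b) : 1 ≤ j ≤ m} equals the additive submonoid of ℤ² generated by {(1,k), (0,−1), (a, 1+b)}. -/
/-- An additive submonoid of an additive group is closed under nonnegative integer multiples. -/
theorem AddSubmonoid.zsmul_mem_of_nonneg {G : Type*} [AddGroup G] (S : AddSubmonoid G) {x : G}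
    (hx : x ∈ S) {n : ℤ} (hn : 0 ≤ n) : n • x ∈ S := by
  lift n to ℕ using hn
  simpa using S.nsmul_mem hx n

/-- The middle Nash blowup chart semigroup `Γ(γ_k, γ_{k+1})` of the two-segment normal
toric surface is generated by `(1,k), (0,−1), (a, 1+b)`, where `b = ak + 1`. -/
theorem two_segment_middle_chart (k m a : ℤ) (hk : 2 ≤ k) (hm : 2 ≤ m) (ha : 1 ≤ a)
    (b : ℤ) (hb : b = a * k + 1) :
    AddSubmonoid.closure
        (({((1 : ℤ), k - 1), ((1 : ℤ), k)} : Set (ℤ × ℤ)) ∪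
          {v : ℤ × ℤ | ∃ j : ℤ, 1 ≤ j ∧ j ≤ k ∧ v = ((0 : ℤ), -j)} ∪
          {v : ℤ × ℤ | ∃ j : ℤ, 1 ≤ j ∧ j ≤ m ∧ v = (j * a, j * b)} ∪
          {v : ℤ × ℤ | ∃ j : ℤ, 1 ≤ j ∧ j ≤ m ∧ v = (j * a, 1 + j * b)}) =
      AddSubmonoid.closure
        ({((1 : ℤ), k), ((0 : ℤ), (-1 : ℤ)), (a, 1 + b)} : Set (ℤ × ℤ)) := by
  apply le_antisymm <;> rw [AddSubmonoid.closure_le]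
  · set S := AddSubmonoid.closure
      ({((1 : ℤ), k), ((0 : ℤ), (-1 : ℤ)), (a, 1 + b)} : Set (ℤ × ℤ))
    have h₁ : ((1 : ℤ), k) ∈ S := AddSubmonoid.subset_closure (by simp)
    have h₂ : ((0 : ℤ), (-1 : ℤ)) ∈ S := AddSubmonoid.subset_closure (by simp)
    have h₃ : (a, 1 + b) ∈ S := AddSubmonoid.subset_closure (by simp)
    have hcomb {q r : ℤ} (hq : 0 ≤ q) (hr : 0 ≤ r) : (r * a, r * (1 + b) - q) ∈ S := by
      convert S.add_mem (S.zsmul_mem_of_nonneg h₃ hr) (S.zsmul_mem_of_nonneg h₂ hq) using 1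
      ext <;> simp [sub_eq_add_neg]
    intro v hv
    rw [SetLike.mem_coe]
    obtain ((hv | ⟨j, hj, -, rfl⟩) | ⟨j, hj, -, rfl⟩) | ⟨j, hj, -, rfl⟩ := hv
    · obtain rfl | rfl := hv
      · simpa [sub_eq_add_neg] using S.add_mem h₁ h₂
      · exact h₁
    · simpa using hcomb (q := j) (r := 0) (by lia) le_rfl
    · convert hcomb (q := j) (r := j) (by lia) (by lia) using 2
      ring
    · convert hcomb (q := j - 1) (r := j) (by lia) (by lia) using 2
      ring
  · rintro v (rfl | rfl | rfl) <;> apply AddSubmonoid.subset_closure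
    · simp
    · exact Or.inl (Or.inl (Or.inr ⟨1, le_rfl, by lia, rfl⟩))
    · exact Or.inr ⟨1, le_rfl, by lia, by simp⟩
end

section
/- Last Nash blowup chart of the two-segment normal toric surface is smooth: let k ≥ 2, m ≥ 2, a ≥ 1 be integers and set b = a·k + 1. Consider the set S = {(1+(m−1)a, k+(m−1)b), (1+ma, k+mb)} ∪ {(−j·a, −j·b) : 1 ≤ j ≤ m} ∪ {(−(m−1)a, −j−(m−1)b) : 1 ≤ j ≤ k} ∪ {(−ma, −j−mb) : 1 ≤ j ≤ k} ⊆ ℤ². Then (a) det of the pair ((1+ma, k+mb), (−a,−b)) equals −1, so these two vectors form a ℤ-basis of ℤ², and (b) the additive submonoid of ℤ² generated by S equals the additive submonoid generated by {(1+ma, k+mb), (−a, −b)}. -/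
/-- Nonnegative integer combinations of `p` and `q` lie in the submonoid they generate. -/
theorem AddSubmonoid.zsmul_add_zsmul_mem_closure_pair {G : Type*} [AddCommGroup G] (p q : G)
    {x y : ℤ} (hx : 0 ≤ x) (hy : 0 ≤ y) :
    x • p + y • q ∈ AddSubmonoid.closure ({p, q} : Set G) := by
  lift x to ℕ using hx
  lift y to ℕ using hy
  exact (AddSubmonoid.mem_closure_pair ..).2 ⟨x, y, by simp⟩


/-- The last Nash blowup chart semigroup `Γ(γ_{k+m}, γ_{k+m+1})` of the two-segment
normal toric surface is generated by the ℤ-basis `(1+ma, k+mb), (−a,−b)` of `ℤ²`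
(their determinant is `−1`), where `b = ak + 1`. -/
theorem two_segment_last_chart_smooth (k m a : ℤ) (hk : 2 ≤ k) (hm : 2 ≤ m) (ha : 1 ≤ a)
    (b : ℤ) (hb : b = a * k + 1) :
    ((1 + m * a) * (-b) - (-a) * (k + m * b) = -1) ∧
    AddSubmonoid.closure
        (({(1 + (m - 1) * a, k + (m - 1) * b), (1 + m * a, k + m * b)} : Set (ℤ × ℤ)) ∪
          {v : ℤ × ℤ | ∃ j : ℤ, 1 ≤ j ∧ j ≤ m ∧ v = (-(j * a), -(j * b))} ∪
          {v : ℤ × ℤ | ∃ j : ℤ, 1 ≤ j ∧ j ≤ k ∧ v = (-((m - 1) * a), -j - (m - 1) * b)} ∪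
          {v : ℤ × ℤ | ∃ j : ℤ, 1 ≤ j ∧ j ≤ k ∧ v = (-(m * a), -j - m * b)}) =
      AddSubmonoid.closure ({(1 + m * a, k + m * b), (-a, -b)} : Set (ℤ × ℤ)) := by
  subst hb
  refine ⟨by ring, le_antisymm ?_ ?_⟩ <;> rw [AddSubmonoid.closure_le]
  · have combination_mem : ∀ x y : ℤ, 0 ≤ x → 0 ≤ y → ∀ v : ℤ × ℤ,
        v = x • (1 + m * a, k + m * (a * k + 1)) + y • (-a, -(a * k + 1)) →
        v ∈ AddSubmonoid.closure
          ({(1 + m * a, k + m * (a * k + 1)), (-a, -(a * k + 1))} : Set (ℤ × ℤ)) := by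
      rintro x y hx hy v rfl
      exact AddSubmonoid.zsmul_add_zsmul_mem_closure_pair _ _ hx hy
    rintro v (((hv | ⟨j, hj, -, rfl⟩) | ⟨j, hj, -, rfl⟩) | ⟨j, hj, -, rfl⟩)
    · rcases hv with rfl | rfl
      · exact combination_mem 1 1 (by simp) (by simp) _ (by ext <;> simp <;> ring)
      · exact AddSubmonoid.subset_closure (by simp)
    · exact combination_mem 0 j le_rfl (by lia) _ (by ext <;> simp <;> ring)
    -- `(0, -1)` is `a` times the first generator plus `1 + m * a` times the second.
    · exact combination_mem (j * a) (j * (1 + m * a) + (m - 1)) (by positivity)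
        (add_nonneg (by positivity) (by lia)) _ (by ext <;> simp <;> ring)
    · exact combination_mem (j * a) (j * (1 + m * a) + m) (by positivity) (by positivity) _
        (by ext <;> simp <;> ring)
  · rintro v (rfl | rfl) <;> apply AddSubmonoid.subset_closure
    · simp
    · exact .inl (.inl (.inr ⟨1, le_rfl, by lia, by simp⟩))
end
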